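/- Let R = k[[x,y,z,t]]/(x² + y² + z² − t^{2b+1}) with k algebraically closed of characteristic zero. Then there exists no reflexive finitely generated R-module M such that End_R(M) is homologically homogeneous (equivalently, such that End_R(M) is a maximal Cohen-Macaulay R-module of finite global dimension). -/

import Mathlib

open MvPowerSeries CategoryTheory RingTheory.Sequence

attribute [local instance] HasDerivedCategory.standard
attribute [local instance] CategoryTheory.hasExt_of_hasDerivedCategory

/-- The equation `x² + y² + z² - t^(2b+1)` in `k⟦x,y,z,t⟧`. -/
noncomputable def cDVeqn (k : Type) [Field k] (b : ℕ) : MvPowerSeries (Fin 4) k :=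
  X 0 ^ 2 + X 1 ^ 2 + X 2 ^ 2 - X 3 ^ (2 * b + 1)

/-- The complete local ring `R = k⟦x,y,z,t⟧/(x² + y² + z² − t^{2b+1})`. -/
noncomputable abbrev cDVring (k : Type) [Field k] (b : ℕ) : Type :=
  MvPowerSeries (Fin 4) k ⧸ Ideal.span {cDVeqn k b}

/-- `depth M ≥ c`: there is an `M`-regular sequence of length `c` of nonunits. -/
def DepthGE (R : Type) [CommRing R] (M : Type) [AddCommGroup M] [Module R M] (c : ℕ) : Prop :=
  ∃ rs : List R, rs.length = c ∧ (∀ r ∈ rs, r ∈ nonunits R) ∧ IsRegular M rs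

/-- A ring `A` has finite global dimension: `Ext^i` vanishes uniformly for large `i`. -/
def FiniteGlobalDimension (A : Type) [Ring A] : Prop :=
  ∃ d : ℕ, ∀ (N N' : ModuleCat.{0} A) (i : ℕ), d < i → Subsingleton (Abelian.Ext N N' i)


namespace CDV

/-- `(y, a, c)` is weakly regular on `N` (explicit form). -/
structure Reg3 {B : Type*} [CommRing B] (y a c : B) (N : Type*) [AddCommGroup N] [Module B N] :
    Prop where
  r1 : ∀ n : N, y • n = 0 → n = 0
  r2 : ∀ w w' : N, a • w = y • w' → ∃ v, w = y • v
  r3 : ∀ w w1 w2 : N, c • w = y • w1 + a • w2 → ∃ v1 v2, w = y • v1 + a • v2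

section local_alg

variable {B : Type*} [CommRing B] {N : Type*} [AddCommGroup N] [Module B N]

theorem exists_min_pres [IsLocalRing B] [Module.Finite B N] :
    ∃ (n : ℕ) (p : (Fin n → B) →ₗ[B] N), Function.Surjective p ∧
      ∀ v, p v = 0 → ∀ i, v i ∈ IsLocalRing.maximalIdeal B := by
  classical
  let κ := IsLocalRing.ResidueField B
  let b := Module.finBasis κ (TensorProduct B κ N)
  have hs : ∀ i, ∃ n : N, (TensorProduct.mk B κ N 1) n = b i := by
    intro i
    exact TensorProduct.mk_surjective B N κ IsLocalRing.residue_surjective (b i)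
  choose g hg using hs
  have hsp := IsLocalRing.span_eq_top_of_tmul_eq_basis (R := B) (M := N) g b (fun i => hg i)
  refine ⟨_, Fintype.linearCombination B g, ?_, ?_⟩
  · rw [← LinearMap.range_eq_top, Fintype.range_linearCombination, hsp]
  · intro v hv i
    have h1 : ∑ i, (IsLocalRing.residue B (v i)) • b i = 0 := by
      rw [Fintype.linearCombination_apply] at hv
      have := congrArg (TensorProduct.mk B κ N 1) hv
      simp only [map_sum, map_smul, map_zero, hg] at this
      rw [← this]
      refine Finset.sum_congr rfl fun i _ => ?_
      exact (algebraMap_smul κ (v i) (b i))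
    have h2 := Fintype.linearIndependent_iff.1 b.linearIndependent _ h1 i
    exact Ideal.Quotient.eq_zero_iff_mem.1 h2

theorem reg3_pi {y a c : B} (h : Reg3 y a c B) (ι : Type*) : Reg3 y a c (ι → B) where
  r1 n hn := funext fun i => h.r1 _ (congrFun hn i)
  r2 w w' hw := by
    choose v hv using fun i => h.r2 (w i) (w' i) (congrFun hw i)
    exact ⟨v, funext hv⟩
  r3 w w1 w2 hw := by
    choose v1 v2 hv using fun i => h.r3 (w i) (w1 i) (w2 i) (congrFun hw i)
    exact ⟨v1, v2, funext hv⟩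

theorem reg3_equiv {y a c : B} {N' : Type*} [AddCommGroup N'] [Module B N'] (e : N ≃ₗ[B] N')
    (h : Reg3 y a c N') : Reg3 y a c N where
  r1 n hn := e.injective (by rw [map_zero]; exact h.r1 _ (by rw [← map_smul, hn, map_zero]))
  r2 w w' hw := by
    obtain ⟨v, hv⟩ := h.r2 (e w) (e w') (by rw [← map_smul, hw, map_smul])
    exact ⟨e.symm v, e.injective (by simp [hv])⟩
  r3 w w1 w2 hw := by
    obtain ⟨v1, v2, hv⟩ := h.r3 (e w) (e w1) (e w2) (by rw [← map_smul, hw]; simp)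
    exact ⟨e.symm v1, e.symm v2, e.injective (by simp [hv])⟩

theorem reg3_free {y a c : B} (h : Reg3 y a c B) [Module.Free B N] [Module.Finite B N]
    [Nontrivial B] : Reg3 y a c N :=
  reg3_equiv (Module.finBasis B N).equivFun (reg3_pi h _)

theorem free_of_reg3 [IsLocalRing B] [IsNoetherianRing B] [Module.Finite B N] {y a c : B}
    (hm : IsLocalRing.maximalIdeal B = Ideal.span {y, a, c}) (h : Reg3 y a c N) :
    Module.Free B N := by
  obtain ⟨n, p, hp, hk⟩ := exists_min_pres (B := B) (N := N)
  have key : LinearMap.ker p ≤ IsLocalRing.maximalIdeal B • LinearMap.ker p := by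
    intro v hv
    have hv0 : p v = 0 := hv
    have h1 : ∀ i, ∃ q : B × B × B, v i = q.1 * y + (q.2.1 * a + q.2.2 * c) := by
      intro i
      have := hk v hv0 i
      rw [hm, Ideal.mem_span_insert] at this
      obtain ⟨s, z, hz, e⟩ := this
      obtain ⟨t, r, e2⟩ := Ideal.mem_span_pair.1 hz
      exact ⟨(s, t, r), by rw [e, ← e2]⟩
    choose q hq using h1
    let v1 : Fin n → B := fun i => (q i).1
    let v2 : Fin n → B := fun i => (q i).2.1
    let v3 : Fin n → B := fun i => (q i).2.2
    have hve : v = y • v1 + (a • v2 + c • v3) := by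
      funext i; simp [v1, v2, v3, hq, mul_comm]
    have e0 : y • p v1 + (a • p v2 + c • p v3) = 0 := by
      rw [hve] at hv0; simpa using hv0
    obtain ⟨w1, w2, hw⟩ := h.r3 (p v3) (-(p v1)) (-(p v2)) (by
      rw [smul_neg, smul_neg, ← sub_eq_zero, ← e0]; abel)
    obtain ⟨w1, rfl⟩ := hp w1
    obtain ⟨w2, rfl⟩ := hp w2
    let u3 := v3 - y • w1 - a • w2
    have hu3 : p u3 = 0 := by simp [u3, hw]
    let u2 := v2 + c • w2
    let u1 := v1 + c • w1
    have hve2 : v = y • u1 + (a • u2 + c • u3) := by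
      rw [hve]; simp only [u1, u2, u3, smul_add, smul_sub, smul_smul, mul_comm c]; abel
    have e1 : y • p u1 + a • p u2 = 0 := by
      rw [hve2] at hv0; simpa [hu3] using hv0
    obtain ⟨w, hw'⟩ := h.r2 (p u2) (-(p u1)) (by
      rw [smul_neg, ← sub_eq_zero, ← e1]; abel)
    obtain ⟨w, rfl⟩ := hp w
    let t2 := u2 - y • w
    let t1 := u1 + a • w
    have ht2 : p t2 = 0 := by simp [t2, hw']
    have hve3 : v = y • t1 + (a • t2 + c • u3) := by
      rw [hve2]; simp only [t1, t2, smul_add, smul_sub, smul_smul, mul_comm a]; abel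
    have ht1 : p t1 = 0 := by
      apply h.r1
      rw [hve3] at hv0; simpa [hu3, ht2] using hv0
    have hin : ∀ s ∈ ({y, a, c} : Set B), s ∈ IsLocalRing.maximalIdeal B := by
      intro s hs; rw [hm]; exact Ideal.subset_span hs
    rw [hve3]
    refine Submodule.add_mem _ (Submodule.smul_mem_smul (hin _ (by simp)) ht1)
      (Submodule.add_mem _ (Submodule.smul_mem_smul (hin _ (by simp)) ht2)
      (Submodule.smul_mem_smul (hin _ (by simp)) hu3))
  have hbot : LinearMap.ker p = ⊥ :=
    Submodule.eq_bot_of_le_smul_of_le_jacobson_bot _ _ (IsNoetherian.noetherian _) key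
      (IsLocalRing.maximalIdeal_le_jacobson _)
  exact Module.Free.of_equiv (LinearEquiv.ofBijective p ⟨LinearMap.ker_eq_bot.1 hbot, hp⟩)

theorem reg3_ker {y a c : B} {G G' : Type*} [AddCommGroup G] [Module B G] [AddCommGroup G']
    [Module B G'] (α : G →ₗ[B] G') (h : Reg3 y a c G) (h' : Reg3 y a c G')
    (htf : ∀ u : G', y • u ∈ LinearMap.range α → u ∈ LinearMap.range α) :
    Reg3 y a c (LinearMap.ker α) where
  r1 n hn := Subtype.ext (h.r1 _ (congrArg Subtype.val hn))
  r2 w w' hw := by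
    obtain ⟨v, hv⟩ := h.r2 w w' (congrArg Subtype.val hw)
    have : α v = 0 := h'.r1 _ (by rw [← map_smul, ← hv]; exact w.2)
    exact ⟨⟨v, this⟩, Subtype.ext hv⟩
  r3 w w1 w2 hw := by
    obtain ⟨v1, v2, hv⟩ := h.r3 w w1 w2 (congrArg Subtype.val hw)
    have h0 : y • α v1 + a • α v2 = 0 := by
      rw [← map_smul, ← map_smul, ← map_add, ← hv]; exact w.2
    obtain ⟨u, hu⟩ := h'.r2 (α v2) (-α v1) (by rw [smul_neg, ← sub_eq_zero, ← h0]; abel)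
    obtain ⟨v', hv'⟩ := htf u (by rw [← hu]; exact ⟨v2, rfl⟩)
    have h2 : α (v2 - y • v') = 0 := by simp [hu, hv']
    have h1 : α (v1 + a • v') = 0 := by
      apply h'.r1
      have : y • a • u = a • α v2 := by rw [hu, smul_comm]
      simp only [map_add, map_smul, hv', smul_add, this, h0]
    exact ⟨⟨_, h1⟩, ⟨_, h2⟩, Subtype.ext (by
      simp only [Submodule.coe_add, Submodule.coe_smul, smul_add, smul_sub]
      rw [smul_comm a y v']; rw [hv]; abel)⟩

/-- third syzygies are free -/
theorem ker_free [IsLocalRing B] [IsNoetherianRing B] {y a c : B}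
    (hm : IsLocalRing.maximalIdeal B = Ideal.span {y, a, c}) (hB : Reg3 y a c B)
    {G G' : Type*} [AddCommGroup G] [Module B G] [AddCommGroup G']
    [Module B G'] [Module.Free B G] [Module.Finite B G] [Module.Free B G'] [Module.Finite B G']
    (α : G →ₗ[B] G')
    (htf : ∀ u : G', y • u ∈ LinearMap.range α → u ∈ LinearMap.range α) :
    Module.Free B (LinearMap.ker α) :=
  free_of_reg3 hm (reg3_ker α (reg3_free hB) (reg3_free hB) htf)

/-- a power of `y` on a second syzygy factors through a projective module. -/
theorem pow_factors [IsLocalRing B] [IsNoetherianRing B] {y a c : B}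
    (hm : IsLocalRing.maximalIdeal B = Ideal.span {y, a, c}) (hB : Reg3 y a c B)
    {G G' : Type*} [AddCommGroup G] [Module B G] [AddCommGroup G']
    [Module B G'] [Module.Free B G] [Module.Finite B G] [Module.Free B G'] [Module.Finite B G']
    (ι : N →ₗ[B] G) (ρ : G →ₗ[B] G') (hι : Function.Injective ι)
    (hex : LinearMap.range ι = LinearMap.ker ρ)
    {F : Type*} [AddCommGroup F] [Module B F] (π : F →ₗ[B] N) (hπ : Function.Surjective π) :
    ∃ (j : ℕ) (s : N →ₗ[B] F), ∀ m, π (s m) = y ^ j • m := by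
  classical
  -- saturation of the image
  let I := LinearMap.range ρ
  let I' : ℕ →o Submodule B G' :=
    ⟨fun j => I.comap (LinearMap.lsmul B G' (y ^ j)), by
      refine monotone_nat_of_le_succ fun j v hv => ?_
      simp only [Submodule.mem_comap, LinearMap.lsmul_apply] at hv ⊢
      rw [pow_succ', mul_smul]
      exact I.smul_mem _ hv⟩
  obtain ⟨j, hj⟩ := monotone_stabilizes_iff_noetherian.2 (inferInstance : IsNoetherian B G') I'
  obtain ⟨s, g, hg⟩ := Module.Finite.exists_fin' B (I' j)
  let α : (Fin s → B) →ₗ[B] G' := (I' j).subtype ∘ₗ g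
  have hα : LinearMap.range α = I' j := by
    rw [LinearMap.range_comp, LinearMap.range_eq_top.2 hg, Submodule.map_top,
      Submodule.range_subtype]
  have hfree : Module.Free B (LinearMap.ker α) := by
    refine ker_free hm hB α fun u hu => ?_
    rw [hα] at hu ⊢
    rw [hj (j + 1) (Nat.le_succ _)]
    change y ^ (j + 1) • u ∈ I
    have : y ^ j • y • u ∈ I := hu
    rwa [smul_smul, ← pow_succ] at this
  have hII : ∀ v ∈ I, v ∈ I' j := fun v hv => I.smul_mem _ hv
  -- lift ρ through α
  obtain ⟨lam, hlam⟩ := Module.projective_lifting_property g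
    (LinearMap.codRestrict (I' j) ρ fun v => hII _ ⟨v, rfl⟩) hg
  have hlam' : ∀ v, α (lam v) = ρ v := fun v => congrArg Subtype.val (LinearMap.congr_fun hlam v)
  obtain ⟨mu, hmu⟩ := Module.projective_lifting_property ρ.rangeRestrict
    (LinearMap.codRestrict I (y ^ j • α) fun v => (g v).2) ρ.surjective_rangeRestrict
  have hmu' : ∀ v, ρ (mu v) = y ^ j • α v :=
    fun v => congrArg Subtype.val (LinearMap.congr_fun hmu v)
  let e : N ≃ₗ[B] LinearMap.ker ρ :=
    (LinearEquiv.ofInjective ι hι).trans (LinearEquiv.ofEq _ _ hex)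
  have he : ∀ n, ((e n : LinearMap.ker ρ) : G) = ι n := fun n => rfl
  -- M → ker α, ker α → M, G → M
  have hιker : ∀ n, ρ (ι n) = 0 := fun n => (e n).2
  let f1 : N →ₗ[B] LinearMap.ker α := LinearMap.codRestrict _ (lam ∘ₗ ι) fun n => by
    simp [hlam', hιker]
  let f2 : LinearMap.ker α →ₗ[B] N := e.symm.toLinearMap ∘ₗ
    LinearMap.codRestrict _ (mu ∘ₗ (LinearMap.ker α).subtype) fun n => by
      have := n.2
      simp only [LinearMap.mem_ker] at this
      simp [hmu', this]
  let f3 : G →ₗ[B] N := e.symm.toLinearMap ∘ₗ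
    LinearMap.codRestrict _ (mu ∘ₗ lam - y ^ j • LinearMap.id) fun n => by
      simp [hmu', hlam']
  have hes : ∀ x, ι (e.symm x) = x := fun x => by rw [← he, e.apply_symm_apply]
  have hid : ∀ n, f2 (f1 n) - f3 (ι n) = y ^ j • n := by
    intro n
    apply hι
    rw [map_sub]
    simp only [f1, f2, f3, LinearMap.comp_apply, LinearEquiv.coe_coe, hes]
    change mu (lam (ι n)) - (mu (lam (ι n)) - y ^ j • ι n) = _
    rw [map_smul]; abel
  obtain ⟨l2, hl2⟩ := Module.projective_lifting_property π f2 hπ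
  obtain ⟨l3, hl3⟩ := Module.projective_lifting_property π f3 hπ
  refine ⟨j, l2 ∘ₗ f1 - l3 ∘ₗ ι, fun m => ?_⟩
  rw [← hid]
  have h2 := LinearMap.congr_fun hl2 (f1 m)
  have h3 := LinearMap.congr_fun hl3 (ι m)
  simp only [LinearMap.comp_apply] at h2 h3
  simp [h2, h3]

end local_alg

end CDV


namespace CDV

section rigidity

variable {R : Type*} [CommRing R] {M F : Type*} [AddCommGroup M] [Module R M]
  [AddCommGroup F] [Module R F]

/-- the linear map on `K` extends to `F` -/
def Ext (K : Submodule R F) (φ : K →ₗ[R] M) : Prop :=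
  ∃ ψ : F →ₗ[R] M, ∀ κ : K, ψ κ = φ κ

theorem factor (π : F →ₗ[R] M) (hπ : Function.Surjective π) (ψ : F →ₗ[R] M)
    (h : ∀ f, π f = 0 → ψ f = 0) : ∃ a : Module.End R M, ∀ f, ψ f = a (π f) := by
  have hle : LinearMap.ker π ≤ LinearMap.ker ψ := fun f hf => h f hf
  refine ⟨(Submodule.liftQ _ ψ hle) ∘ₗ (π.quotKerEquivOfSurjective hπ).symm.toLinearMap,
    fun f => ?_⟩
  have : (π.quotKerEquivOfSurjective hπ).symm (π f) = Submodule.Quotient.mk f := by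
    rw [LinearEquiv.symm_apply_eq]; rfl
  simp [this]

theorem end_ext (π : F →ₗ[R] M) (hπ : Function.Surjective π) {a a' : Module.End R M}
    (h : ∀ f, a (π f) = a' (π f)) : a = a' := by
  ext m; obtain ⟨f, rfl⟩ := hπ m; exact h f

theorem ext_step (π : F →ₗ[R] M) (hπ : Function.Surjective π) (I : Ideal R) {r1 r2 r3 x y : R}
    (h1 : r1 ∈ I) (h2 : r2 ∈ I) (h3 : r3 ∈ I) (hx : x ∈ I) (hy : y ∈ I)
    (hA : Reg3 r1 r2 r3 (Module.End R M))
    (hM1 : ∀ m : M, x • m = 0 → m = 0)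
    (hM2 : ∀ w w' : M, y • w = x • w' → ∃ v, w = x • v)
    (φ : LinearMap.ker π →ₗ[R] M) (hφ : ∀ r ∈ I, Ext _ (r • φ)) : Ext _ φ := by
  classical
  choose ψ hψ using hφ
  have hψ' : ∀ r hr f (hf : π f = 0), ψ r hr f = r • φ ⟨f, hf⟩ :=
    fun r hr f hf => hψ r hr ⟨f, hf⟩
  have hc : ∀ r (hr : r ∈ I), ∃ c : Module.End R M,
      ∀ f, r1 • ψ r hr f - r • ψ r1 h1 f = c (π f) := by
    intro r hr
    obtain ⟨a, ha⟩ := factor π hπ (r1 • ψ r hr - r • ψ r1 h1) (fun f hf => by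
      simp [hψ' _ _ f hf, smul_comm r r1])
    exact ⟨a, fun f => by rw [← ha]; rfl⟩
  choose c hc using hc
  have hd : ∀ r s (hr : r ∈ I) (hs : s ∈ I), ∃ d : Module.End R M,
      s • c r hr = r • c s hs + r1 • d := by
    intro r s hr hs
    obtain ⟨a, ha⟩ := factor π hπ (s • ψ r hr - r • ψ s hs) (fun f hf => by
      simp [hψ' _ _ f hf, smul_comm r s])
    refine ⟨a, end_ext π hπ fun f => ?_⟩
    simp only [LinearMap.add_apply, LinearMap.smul_apply, ← hc, ← ha, LinearMap.sub_apply]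
    simp only [smul_sub, smul_smul]
    rw [mul_comm s r1, mul_comm s r, mul_comm r r1]; abel
  obtain ⟨d, hd1⟩ := hd r2 r3 h2 h3
  obtain ⟨d', α, hα⟩ := hA.r3 (c r2 h2) d (c r3 h3) (by rw [hd1, add_comm])
  have hβ : ∀ r (hr : r ∈ I), ∃ β : Module.End R M, c r hr - r • α = r1 • β := by
    intro r hr
    obtain ⟨e, he⟩ := hd r r2 hr h2
    refine hA.r2 _ (e + r • d') ?_
    rw [smul_sub, he, hα]
    simp only [smul_add, smul_smul]
    rw [mul_comm r r1, mul_comm r r2]; abel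
  choose β hβ using hβ
  let Ψ : ∀ r, r ∈ I → (F →ₗ[R] M) := fun r hr => ψ r hr - β r hr ∘ₗ π
  have hΨ : ∀ r hr f, r1 • Ψ r hr f = r • (ψ r1 h1 f + α (π f)) := by
    intro r hr f
    have e1 := hc r hr f
    have e2 := LinearMap.congr_fun (hβ r hr) (π f)
    simp only [LinearMap.sub_apply, LinearMap.smul_apply] at e2
    simp only [Ψ, LinearMap.sub_apply, LinearMap.comp_apply, smul_sub, smul_add, ← e2, ← e1]
    abel
  have hxy : ∀ f, y • Ψ x hx f = x • Ψ y hy f := by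
    obtain ⟨a, ha⟩ := factor π hπ (y • Ψ x hx - x • Ψ y hy) (fun f hf => by
      simp [Ψ, hf, hψ' _ _ f hf, smul_comm x y])
    have : a = 0 := hA.r1 _ (end_ext π hπ fun f => by
      simp only [LinearMap.smul_apply, ← ha, LinearMap.sub_apply, smul_sub, LinearMap.zero_apply]
      rw [smul_comm r1 y, smul_comm r1 x, hΨ, hΨ, smul_comm x y, sub_self])
    intro f
    have := ha f
    rw [‹a = 0›] at this
    simpa [sub_eq_zero] using this
  choose Φ hΦ using fun f => hM2 _ _ (hxy f)
  have hinj : ∀ u v : M, x • u = x • v → u = v := fun u v h =>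
    sub_eq_zero.1 (hM1 _ (by rw [smul_sub, h, sub_self]))
  refine ⟨{ toFun := Φ, map_add' := ?_, map_smul' := ?_ }, ?_⟩
  · intro f g; apply hinj; rw [smul_add, ← hΦ, ← hΦ, ← hΦ, map_add]
  · intro r f; apply hinj; rw [RingHom.id_apply, smul_comm, ← hΦ, ← hΦ, map_smul]
  · rintro ⟨f, hf⟩
    apply hinj
    change x • Φ f = _
    rw [← hΦ]
    have hf' : π f = 0 := hf
    simp [Ψ, hf', hψ' _ _ f hf']

/-- The ideal of elements whose multiplication factors through `π`. -/
def AnnI (π : F →ₗ[R] M) : Ideal R where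
  carrier := {c | ∃ s : M →ₗ[R] F, ∀ m, π (s m) = c • m}
  add_mem' := by
    rintro a b ⟨s, hs⟩ ⟨t, ht⟩
    exact ⟨s + t, fun m => by simp [hs, ht, add_smul]⟩
  zero_mem' := ⟨0, fun m => by simp⟩
  smul_mem' := by
    rintro c a ⟨s, hs⟩
    exact ⟨c • s, fun m => by simp [hs, mul_smul]⟩

theorem ext_of_ann (π : F →ₗ[R] M) {c : R} (hc : c ∈ AnnI π) (φ : LinearMap.ker π →ₗ[R] M) :
    Ext _ (c • φ) := by
  obtain ⟨s, hs⟩ := hc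
  refine ⟨φ ∘ₗ LinearMap.codRestrict _ (c • LinearMap.id - s ∘ₗ π) (fun f => by simp [hs]), ?_⟩
  rintro ⟨f, hf⟩
  have hf' : π f = 0 := hf
  rw [LinearMap.smul_apply, ← map_smul, LinearMap.comp_apply]
  congr 1
  ext
  simp [hf']

theorem rigid (π : F →ₗ[R] M) (hπ : Function.Surjective π) (I : Ideal R) {r1 r2 r3 x y : R}
    (h1 : r1 ∈ I) (h2 : r2 ∈ I) (h3 : r3 ∈ I) (hx : x ∈ I) (hy : y ∈ I)
    (hA : Reg3 r1 r2 r3 (Module.End R M))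
    (hM1 : ∀ m : M, x • m = 0 → m = 0)
    (hM2 : ∀ w w' : M, y • w = x • w' → ∃ v, w = x • v)
    (n : ℕ) (hn : I ^ n ≤ AnnI π)
    (φ : LinearMap.ker π →ₗ[R] M) : Ext _ φ := by
  have main : ∀ n : ℕ, ∀ φ : LinearMap.ker π →ₗ[R] M,
      (∀ r ∈ I ^ n, Ext _ (r • φ)) → Ext _ φ := by
    intro n
    induction n with
    | zero =>
      intro φ h
      have := h 1 (by simp)
      rwa [one_smul] at this
    | succ n ih =>
      intro φ h
      refine ih φ fun s hs => ?_
      refine ext_step π hπ I h1 h2 h3 hx hy hA hM1 hM2 _ fun r hr => ?_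
      rw [smul_smul]
      exact h _ (by rw [pow_succ']; exact Ideal.mul_mem_mul hr hs)
  exact main n φ fun r hr => ext_of_ann π (hn hr) φ

/-- averaging over a double cover -/
theorem double_mem_ann {B : Type*} [CommRing B] [IsLocalRing B] [IsNoetherianRing B] [Algebra B R]
    [Module.Free B R] [Module.Finite B R] {z : R} {g : B}
    (hspan : ∀ r : R, ∃ a b : B, r = algebraMap B R a + algebraMap B R b * z)
    (hz : z ^ 2 = algebraMap B R g)
    {y a c : B} (hm : IsLocalRing.maximalIdeal B = Ideal.span {y, a, c}) (hB : Reg3 y a c B)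
    {p q : ℕ} (ι : M →ₗ[R] (Fin p → R)) (ρ : (Fin p → R) →ₗ[R] (Fin q → R))
    (hι : Function.Injective ι) (hex : LinearMap.range ι = LinearMap.ker ρ)
    (π : F →ₗ[R] M) (hπ : Function.Surjective π) :
    ∃ j, 2 * z * (algebraMap B R y) ^ j ∈ AnnI π := by
  let _ : Module B M := Module.compHom M (algebraMap B R)
  let _ : Module B F := Module.compHom F (algebraMap B R)
  have _ : IsScalarTower B R M := ⟨fun b r m => by
    rw [Algebra.smul_def, mul_smul]; rfl⟩
  have _ : IsScalarTower B R F := ⟨fun b r m => by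
    rw [Algebra.smul_def, mul_smul]; rfl⟩
  have hbm : ∀ (b : B) (m : M), b • m = algebraMap B R b • m := fun _ _ => rfl
  have hbf : ∀ (b : B) (m : F), b • m = algebraMap B R b • m := fun _ _ => rfl
  obtain ⟨j, s, hs⟩ := pow_factors hm hB (ι.restrictScalars B) (ρ.restrictScalars B) hι
    (by ext v; have := SetLike.ext_iff.1 hex v; simpa using this) (π.restrictScalars B) hπ
  refine ⟨j, ?_⟩
  have hs' : ∀ (b : B) (m : M), s (algebraMap B R b • m) = algebraMap B R b • s m :=
    fun b m => s.map_smul b m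
  refine ⟨{ toFun := fun m => z • s m + s (z • m), map_add' := ?_, map_smul' := ?_ }, ?_⟩
  · intro m n; simp only [smul_add, map_add]; abel
  · intro r m
    obtain ⟨a, b, rfl⟩ := hspan r
    have hzz : z • z • m = algebraMap B R g • m := by rw [smul_smul, ← pow_two, hz]
    have hzz' : z • z • s m = algebraMap B R g • s m := by rw [smul_smul, ← pow_two, hz]
    simp only [RingHom.id_apply, add_smul, mul_smul, map_add, hs', smul_add]
    rw [smul_comm z (algebraMap B R a) m, smul_comm z (algebraMap B R b) (z • m), hs', hzz, hs',
      hs', hzz', smul_comm z (algebraMap B R a), smul_comm z (algebraMap B R b)]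
    abel
  · intro m
    have h1 : ∀ m, π (s m) = (algebraMap B R y) ^ j • m := fun m => by
      have := hs m
      rw [hbm, map_pow] at this
      exact this
    simp only [LinearMap.coe_mk, AddHom.coe_mk, map_add, map_smul, h1]
    simp only [smul_smul, ← add_smul]
    congr 1
    ring

end rigidity

end CDV


namespace CDV

section theta

variable {k : Type*} [Field k]

/-- `Θ` acts as `c μ` on the generalized eigenspace of `N` for `μ`. -/
def ActsBy {V : Type*} [AddCommGroup V] [Module k V] (c : k → k) (N Θ : Module.End k V) : Prop :=
  ∀ μ, ∀ v ∈ N.maxGenEigenspace μ, Θ v = c μ • v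

theorem exists_actsBy [IsAlgClosed k] {V : Type*} [AddCommGroup V] [Module k V]
    [FiniteDimensional k V] (c : k → k) (N : Module.End k V) :
    ∃ Θ : Module.End k V, ActsBy c N Θ := by
  classical
  have hInternal : DirectSum.IsInternal (fun μ => N.maxGenEigenspace μ) :=
    DirectSum.isInternal_submodule_of_iSupIndep_of_iSup_eq_top
      N.independent_maxGenEigenspace (Module.End.iSup_maxGenEigenspace_eq_top N)
  let e := LinearEquiv.ofBijective (DirectSum.coeLinearMap fun μ => N.maxGenEigenspace μ) hInternal
  refine ⟨(DirectSum.toModule k k V fun μ => c μ • (N.maxGenEigenspace μ).subtype) ∘ₗ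
    e.symm.toLinearMap, fun μ v hv => ?_⟩
  have : e.symm v = DirectSum.lof k k (fun μ => N.maxGenEigenspace μ) μ ⟨v, hv⟩ := by
    rw [LinearEquiv.symm_apply_eq]
    exact (DirectSum.coeLinearMap_lof (fun μ => N.maxGenEigenspace μ) μ ⟨v, hv⟩).symm
  simp [this]

theorem maxGen_shift {V V' : Type*} [AddCommGroup V] [Module k V] [AddCommGroup V'] [Module k V']
    (N : Module.End k V) (N' : Module.End k V') (T : V →ₗ[k] V') (w : k)
    (hT : ∀ v, N' (T v) = T (N v) + w • T v) (μ : k) (v : V) (hv : v ∈ N.maxGenEigenspace μ) :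
    T v ∈ N'.maxGenEigenspace (μ + w) := by
  rw [Module.End.mem_maxGenEigenspace] at hv ⊢
  obtain ⟨n, hn⟩ := hv
  refine ⟨n, ?_⟩
  have : ∀ n v, ((N' - (μ + w) • (1 : Module.End k V')) ^ n) (T v) =
      T (((N - μ • (1 : Module.End k V)) ^ n) v) := by
    intro n
    induction n with
    | zero => intro v; simp
    | succ n ih =>
      intro v
      rw [pow_succ, pow_succ, Module.End.mul_apply, Module.End.mul_apply, ← ih]
      congr 1
      simp [hT, add_smul]
  rw [this, hn, map_zero]

theorem actsBy_shift [IsAlgClosed k] {V V' : Type*} [AddCommGroup V] [Module k V]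
    [FiniteDimensional k V] [AddCommGroup V'] [Module k V'] {c : k → k}
    {N Θ : Module.End k V} {N' Θ' : Module.End k V'} (h : ActsBy c N Θ) (h' : ActsBy c N' Θ')
    (T : V →ₗ[k] V') (w ε : k) (hT : ∀ v, N' (T v) = T (N v) + w • T v)
    (hc : ∀ μ, c (μ + w) = ε * c μ) (v : V) : Θ' (T v) = ε • T (Θ v) := by
  have hv : v ∈ ⨆ μ, N.maxGenEigenspace μ := by
    rw [Module.End.iSup_maxGenEigenspace_eq_top N]; trivial
  induction hv using Submodule.iSup_induction' with
  | mem μ v hv =>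
    rw [h μ v hv, h' _ _ (maxGen_shift N N' T w hT μ v hv), hc, map_smul, smul_smul]
  | zero => simp
  | add v v' _ _ e e' => simp [e, e']

theorem actsBy_sq [IsAlgClosed k] {V : Type*} [AddCommGroup V] [Module k V]
    [FiniteDimensional k V] {c : k → k} {N Θ : Module.End k V} (h : ActsBy c N Θ)
    (hc : ∀ μ, c μ * c μ = 1) (v : V) : Θ (Θ v) = v := by
  have hv : v ∈ ⨆ μ, N.maxGenEigenspace μ := by
    rw [Module.End.iSup_maxGenEigenspace_eq_top N]; trivial
  induction hv using Submodule.iSup_induction' with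
  | mem μ v hv =>
    rw [h μ v hv, map_smul, h μ v hv, smul_smul, hc, one_smul]
  | zero => simp
  | add v v' _ _ e e' => simp [e, e']

theorem exists_theta [IsAlgClosed k] {M : Type*} [AddCommGroup M] [Module k M]
    (W : ℕ → Submodule k M) (hW : Antitone W) (hfd : ∀ j, FiniteDimensional k (M ⧸ W j))
    (hH : ∀ m, (∀ j, m ∈ W j) → m = 0)
    (hC : ∀ s : ℕ → M, (∀ i j, i ≤ j → s i - s j ∈ W i) → ∃ L, ∀ i, s i - L ∈ W i)
    (N : Module.End k M) (hN : ∀ j, W j ≤ (W j).comap N) (c : k → k) (hc : ∀ μ, c μ * c μ = 1) :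
    ∃ Θ : Module.End k M, (∀ m, Θ (Θ m) = m) ∧ (∀ j, ∀ m ∈ W j, Θ m ∈ W j) ∧
      ∀ (T : Module.End k M) (w ε : k), (∀ j, W j ≤ (W j).comap T) →
        (∀ v, N (T v) = T (N v) + w • T v) → (∀ μ, c (μ + w) = ε * c μ) →
        ∀ m, Θ (T m) = ε • T (Θ m) := by
  classical
  choose Θj hΘj using fun j => exists_actsBy c ((W j).mapQ (W j) N (hN j))
  have hcomp : ∀ i j (hij : i ≤ j) (v : M ⧸ W j),
      Θj i ((W j).mapQ (W i) LinearMap.id (hW hij) v) =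
        (W j).mapQ (W i) LinearMap.id (hW hij) (Θj j v) := by
    intro i j hij v
    have := actsBy_shift (hΘj j) (hΘj i) ((W j).mapQ (W i) LinearMap.id (hW hij)) 0 1
      (fun v => by
        induction v using Submodule.Quotient.induction_on with
        | H m => simp) (fun μ => by simp) v
    simpa using this
  have hex : ∀ m : M, ∃ L : M, ∀ j, (W j).mkQ L = Θj j ((W j).mkQ m) := by
    intro m
    choose s hs using fun j => (W j).mkQ_surjective (Θj j ((W j).mkQ m))
    obtain ⟨L, hL⟩ := hC s (fun i j hij => by
      rw [← Submodule.Quotient.eq]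
      change (W i).mkQ (s i) = (W i).mkQ (s j)
      rw [hs i]
      have e := hcomp i j hij ((W j).mkQ m)
      rw [← hs j] at e
      simpa using e)
    refine ⟨L, fun j => ?_⟩
    rw [← hs j]
    exact ((Submodule.Quotient.eq _).2 (hL j)).symm
  choose Θ hΘ using hex
  have huniq : ∀ a b : M, (∀ j, (W j).mkQ a = (W j).mkQ b) → a = b := by
    intro a b h
    refine sub_eq_zero.1 (hH _ fun j => ?_)
    exact (Submodule.Quotient.eq _).1 (h j)
  let Θl : Module.End k M :=
    { toFun := Θ
      map_add' := fun a b => huniq _ _ fun j => by simp only [map_add, hΘ]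
      map_smul' := fun a b => huniq _ _ fun j => by simp only [map_smul, hΘ, RingHom.id_apply] }
  have hΘl : ∀ m j, (W j).mkQ (Θl m) = Θj j ((W j).mkQ m) := hΘ
  refine ⟨Θl, fun m => ?_, fun j m hm => ?_, fun T w ε hT hTN hcw m => ?_⟩
  · apply huniq; intro j
    rw [hΘl, hΘl, actsBy_sq (hΘj j) hc]
  · have : (W j).mkQ m = 0 := by simpa using hm
    have h2 := hΘl m j
    rw [this, map_zero] at h2
    simpa using h2
  · apply huniq; intro j
    rw [hΘl, map_smul]
    have := actsBy_shift (hΘj j) (hΘj j) ((W j).mapQ (W j) T (hT j)) w ε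
      (fun v => by
        induction v using Submodule.Quotient.induction_on with
        | H m => 
          simp only [Submodule.mapQ_apply, hTN]
          simp) hcw ((W j).mkQ m)
    rw [← hΘl] at this
    simpa using this

theorem exists_sign [CharZero k] : ∃ c : k → k, (∀ μ, c μ * c μ = 1) ∧
    ∀ μ (n : ℤ), c (μ + n) = (-1 : k) ^ n * c μ := by
  classical
  let H := AddSubgroup.zmultiples (1 : k)
  have h1 : ∀ μ : k, ∃ n : ℤ, μ = ((QuotientAddGroup.mk μ : k ⧸ H)).out + n := by
    intro μ
    have : ((QuotientAddGroup.mk (((QuotientAddGroup.mk μ : k ⧸ H)).out)) : k ⧸ H) =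
      QuotientAddGroup.mk μ := QuotientAddGroup.out_eq' _
    rw [QuotientAddGroup.eq] at this
    obtain ⟨n, hn⟩ := AddSubgroup.mem_zmultiples_iff.1 this
    refine ⟨n, ?_⟩
    simp at hn
    rw [hn]; ring
  choose n hn using h1
  have hne : (-1 : k) ≠ 0 := by simp
  refine ⟨fun μ => (-1 : k) ^ (n μ), fun μ => ?_, fun μ a => ?_⟩
  · rw [← zpow_add₀ hne, Even.neg_one_zpow ⟨n μ, rfl⟩]
  · have h2 : (QuotientAddGroup.mk (μ + a) : k ⧸ H) = QuotientAddGroup.mk μ := by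
      rw [eq_comm, QuotientAddGroup.eq]
      exact AddSubgroup.mem_zmultiples_iff.2 ⟨a, by simp⟩
    have h3 := hn (μ + a)
    rw [h2] at h3
    have h4 : (n (μ + a) : k) = ((a + n μ : ℤ) : k) := by
      have := hn μ
      push_cast
      linear_combination this - h3
    have h5 : n (μ + a) = a + n μ := by exact_mod_cast h4
    simp only [h5]
    rw [zpow_add₀ hne]

end theta

section connection

variable {k : Type*} [Field k] {R : Type*} [CommRing R] [Algebra k R]
  {M : Type*} [AddCommGroup M] [Module R M] [Module k M] [IsScalarTower k R M]

/-- lifting a derivation to a connection -/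
theorem exists_nabla (D : Derivation k R R) {n : ℕ} (π : (Fin n → R) →ₗ[R] M)
    (hπ : Function.Surjective π) (hrig : ∀ φ : LinearMap.ker π →ₗ[R] M, Ext _ φ) :
    ∃ N : Module.End k M, ∀ (r : R) m, N (r • m) = D r • m + r • N m := by
  let DF : (Fin n → R) → (Fin n → R) := fun f i => D (f i)
  have hDF : ∀ (r : R) f, DF (r • f) = D r • f + r • DF f := by
    intro r f; funext i
    simp only [DF, Pi.smul_apply, Pi.add_apply, smul_eq_mul, Derivation.leibniz]
    ring
  have hDFa : ∀ f g, DF (f + g) = DF f + DF g := by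
    intro r f; funext i; simp [DF]
  have hDFk : ∀ (c : k) f, DF (c • f) = c • DF f := by
    intro r f; funext i; simp [DF]
  obtain ⟨ψ, hψ⟩ := hrig
    { toFun := fun κ => π (DF κ)
      map_add' := fun a b => by simp [hDFa]
      map_smul' := fun r a => by
        have : π a = 0 := a.2
        simp [hDF, this] }
  have hψ' : ∀ f, π f = 0 → ψ f = π (DF f) := fun f hf => hψ ⟨f, hf⟩
  choose s hs using hπ
  have hwd : ∀ f, π (DF f) - ψ f = π (DF (s (π f))) - ψ (s (π f)) := by
    intro f
    have h0 : π (f - s (π f)) = 0 := by simp [hs]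
    have h1 := hψ' _ h0
    have h2 : DF (f - s (π f)) = DF f - DF (s (π f)) := by
      funext i; simp [DF]
    rw [h2, map_sub, map_sub] at h1
    rw [sub_eq_sub_iff_add_eq_add]
    have := sub_eq_sub_iff_add_eq_add.1 h1
    rw [← this, add_comm]
  let N : M → M := fun m => π (DF (s m)) - ψ (s m)
  have hN : ∀ f, N (π f) = π (DF f) - ψ f := fun f => (hwd f).symm
  have hNa : ∀ a b, N (a + b) = N a + N b := by
    intro a b
    rw [← hs a, ← hs b, ← map_add, hN, hN, hN, hDFa, map_add, map_add]; abel
  have hNr : ∀ (r : R) m, N (r • m) = D r • m + r • N m := by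
    intro r a
    rw [← hs a, ← map_smul, hN, hN, hDF, map_add, map_smul, map_smul, map_smul, smul_sub]; abel
  refine ⟨{ toFun := N, map_add' := hNa, map_smul' := fun c m => ?_ }, hNr⟩
  have := hNr (algebraMap k R c) m
  simpa [algebraMap_smul] using this

theorem finite_codim [Module.Finite R M] {ι : Type*} [Fintype ι] (x : ι → R) (I : Ideal R)
    (hx : ∀ i, x i ∈ I) (hgen : ∀ r : R, ∃ (c : k) (q : ι → R), r = algebraMap k R c + ∑ i, x i * q i)
    (j : ℕ) : FiniteDimensional k (M ⧸ (I ^ j • (⊤ : Submodule R M)).restrictScalars k) := by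
  obtain ⟨s, hs⟩ := (Module.Finite.fg_top : (⊤ : Submodule R M).FG)
  let V : Submodule k M := Submodule.span k s
  have hV : V.FG := ⟨s, rfl⟩
  have h1 : ∀ m : M, ∃ v ∈ V, ∃ q : ι → M, m = v + ∑ i, x i • q i := by
    intro m
    have hm : m ∈ Submodule.span R (s : Set M) := by rw [hs]; trivial
    induction hm using Submodule.span_induction with
    | mem m hm => exact ⟨m, Submodule.subset_span hm, 0, by simp⟩
    | zero => exact ⟨0, V.zero_mem, 0, by simp⟩
    | add a b _ _ ha hb =>
      obtain ⟨v, hv, q, rfl⟩ := ha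
      obtain ⟨v', hv', q', rfl⟩ := hb
      exact ⟨v + v', V.add_mem hv hv', q + q', by simp [Finset.sum_add_distrib]; abel⟩
    | smul r a _ ha =>
      obtain ⟨v, hv, q, rfl⟩ := ha
      obtain ⟨c, p, rfl⟩ := hgen r
      refine ⟨c • v, V.smul_mem _ hv, fun i => p i • v + (algebraMap k R c + ∑ i, x i * p i) • q i,
        ?_⟩
      simp only [smul_add, Finset.sum_add_distrib, add_smul, Finset.sum_smul, mul_smul,
        Finset.smul_sum, algebraMap_smul]
      simp only [smul_comm (x _) c]
      simp only [smul_comm (x _) (p _), smul_comm (x _) (x _)]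
      rw [Finset.sum_comm]
      abel
  have key : ∀ j : ℕ, ∃ U : Submodule k M, U.FG ∧ ∀ m : M, ∃ u ∈ U,
      m - u ∈ I ^ j • (⊤ : Submodule R M) := by
    intro j
    induction j with
    | zero => exact ⟨⊥, Submodule.fg_bot, fun m => ⟨0, Submodule.zero_mem _, by simp⟩⟩
    | succ j ih =>
      obtain ⟨U, hU, hU'⟩ := ih
      refine ⟨V ⊔ ⨆ i, U.map (LinearMap.lsmul R M (x i) |>.restrictScalars k),
        hV.sup (Submodule.fg_iSup _ fun i => hU.map _), fun m => ?_⟩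
      obtain ⟨v, hv, q, rfl⟩ := h1 m
      choose u hu hu' using fun i => hU' (q i)
      refine ⟨v + ∑ i, x i • u i, Submodule.add_mem_sup hv (Submodule.sum_mem _ fun i _ =>
        Submodule.mem_iSup_of_mem i ⟨u i, hu i, rfl⟩), ?_⟩
      rw [add_sub_add_left_eq_sub, ← Finset.sum_sub_distrib]
      refine Submodule.sum_mem _ fun i _ => ?_
      rw [← smul_sub, pow_succ', mul_smul]
      exact Submodule.smul_mem_smul (hx i) (hu' i)
  obtain ⟨U, hU, hU'⟩ := key j
  have : FiniteDimensional k U := Module.Finite.iff_fg.2 hU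
  refine Module.Finite.of_surjective
    (((I ^ j • (⊤ : Submodule R M)).restrictScalars k).mkQ ∘ₗ U.subtype) ?_
  intro v
  obtain ⟨m, rfl⟩ := Submodule.mkQ_surjective _ v
  obtain ⟨u, hu, hmu⟩ := hU' m
  exact ⟨⟨u, hu⟩, ((Submodule.Quotient.eq _).2 hmu).symm⟩

theorem exists_semilinear [IsAlgClosed k] [CharZero k] [Module.Finite R M] {ι : Type*} [Fintype ι]
    (x : ι → R) (w : ι → ℤ) (I : Ideal R) (hI : I = Ideal.span (Set.range x))
    (hgen : ∀ r : R, ∃ (c : k) (q : ι → R), r = algebraMap k R c + ∑ i, x i * q i)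
    (D : Derivation k R R) (hD : ∀ i, D (x i) = (w i : k) • x i)
    (σ : R →ₐ[k] R) (hσ : ∀ i, σ (x i) = ((-1 : k) ^ (w i)) • x i)
    [IsHausdorff I M] [IsPrecomplete I M] {n : ℕ} (π : (Fin n → R) →ₗ[R] M)
    (hπ : Function.Surjective π) (hrig : ∀ φ : LinearMap.ker π →ₗ[R] M, Ext _ φ) :
    ∃ Θ : Module.End k M, (∀ m, Θ (Θ m) = m) ∧ ∀ (r : R) m, Θ (r • m) = σ r • Θ m := by
  have hx : ∀ i, x i ∈ I := fun i => hI ▸ Ideal.subset_span ⟨i, rfl⟩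
  obtain ⟨N, hN⟩ := exists_nabla (k := k) D π hπ hrig
  obtain ⟨c, hc, hcn⟩ := exists_sign (k := k)
  have hDI : ∀ r ∈ I, D r ∈ I := by
    intro r hr
    rw [hI] at hr
    induction hr using Submodule.span_induction with
    | mem r hr => obtain ⟨i, rfl⟩ := hr; rw [hD]; exact Submodule.smul_of_tower_mem _ _ (hx i)
    | zero => simp
    | add a b _ _ ha hb => rw [map_add]; exact I.add_mem ha hb
    | smul r a h ha =>
      rw [smul_eq_mul, Derivation.leibniz]
      refine I.add_mem (I.smul_mem _ ha) ?_
      rw [smul_eq_mul, mul_comm]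
      refine I.mul_mem_left _ ?_
      rw [hI]; exact h
  have hNI : ∀ j : ℕ, ∀ m ∈ I ^ j • (⊤ : Submodule R M), N m ∈ I ^ j • (⊤ : Submodule R M) := by
    intro j
    induction j with
    | zero => intro m _; simp
    | succ j ih =>
      intro m hm
      rw [pow_succ', mul_smul] at hm ⊢
      induction hm using Submodule.smul_induction_on' with
      | smul r hr m hm =>
        rw [hN]
        exact Submodule.add_mem _ (Submodule.smul_mem_smul (hDI r hr) hm)
          (Submodule.smul_mem_smul hr (ih _ hm))
      | add a _ b _ ha hb => rw [map_add]; exact Submodule.add_mem _ ha hb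
  obtain ⟨Θ, hΘ2, hΘW, hΘT⟩ := exists_theta
    (fun j => (I ^ j • (⊤ : Submodule R M)).restrictScalars k)
    (fun i j hij m hm => Submodule.smul_mono_left (Ideal.pow_le_pow_right hij) hm)
    (fun j => finite_codim x I hx hgen j)
    (fun m hm => IsHausdorff.haus ‹_› m fun j => by
      rw [SModEq.sub_mem, sub_zero]; exact hm j)
    (fun s hs => by
      obtain ⟨L, hL⟩ := IsPrecomplete.prec (I := I) (M := M) ‹_› (f := s) (fun {i j} hij => by
        rw [SModEq.sub_mem]; exact hs i j hij)
      exact ⟨L, fun i => by have := hL i; rwa [SModEq.sub_mem] at this⟩)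
    N hNI c hc
  have hΘx : ∀ i m, Θ (x i • m) = σ (x i) • Θ m := by
    intro i m
    have := hΘT (LinearMap.lsmul R M (x i) |>.restrictScalars k) (w i) ((-1 : k) ^ w i)
      (fun j m hm => Submodule.smul_mem (I ^ j • (⊤ : Submodule R M)) (x i) hm)
      (fun v => by
        simp [hN, hD, add_comm])
      (fun μ => hcn μ _) m
    rw [hσ, smul_assoc]
    exact this
  refine ⟨Θ, hΘ2, fun r m => ?_⟩
  have main : ∀ j : ℕ, ∀ r m, Θ (r • m) - σ r • Θ m ∈ I ^ j • (⊤ : Submodule R M) := by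
    intro j
    induction j with
    | zero => intro r m; simp
    | succ j ih =>
      intro r m
      obtain ⟨c, q, rfl⟩ := hgen r
      have : Θ ((algebraMap k R c + ∑ i, x i * q i) • m) -
          σ (algebraMap k R c + ∑ i, x i * q i) • Θ m =
          ∑ i, ((-1 : k) ^ (w i)) • x i • (Θ (q i • m) - σ (q i) • Θ m) := by
        simp only [add_smul, map_add, Finset.sum_smul, map_sum, mul_smul, map_mul, hΘx,
          algebraMap_smul, map_smul, AlgHom.commutes, smul_sub, Finset.sum_sub_distrib]
        simp only [hσ, smul_assoc]
        abel
      rw [this]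
      refine Submodule.sum_mem _ fun i _ => Submodule.smul_of_tower_mem _ _ ?_
      rw [pow_succ', mul_smul]
      exact Submodule.smul_mem_smul (hx i) (ih _ _)
  refine sub_eq_zero.1 (IsHausdorff.haus (I := I) ‹_› _ fun j => ?_)
  rw [SModEq.sub_mem, sub_zero]; exact main j r m

end connection

end CDV


namespace CDV

section split

/-- `R` is free over `B` with basis `1, z`. -/
structure Dbl (B R : Type*) [CommRing B] [CommRing R] [Algebra B R] (z : R) (g : B)
    (a0 a1 : R →ₗ[B] B) : Prop where
  sq : z * z = algebraMap B R g
  dec : ∀ r, r = algebraMap B R (a0 r) + algebraMap B R (a1 r) * z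
  c0 : ∀ a b, a0 (algebraMap B R a + algebraMap B R b * z) = a
  c1 : ∀ a b, a1 (algebraMap B R a + algebraMap B R b * z) = b

variable {B R : Type*} [CommRing B] [CommRing R] [Algebra B R] {z : R} {g : B}
    {a0 a1 : R →ₗ[B] B}

theorem Dbl.c0z (h : Dbl B R z g a0 a1) (r : R) : a0 (z * r) = g * a1 r := by
  have : z * r = algebraMap B R (g * a1 r) + algebraMap B R (a0 r) * z := by
    conv_lhs => rw [h.dec r]
    rw [map_mul, ← h.sq]; ring
  rw [this, h.c0]

theorem Dbl.c1z (h : Dbl B R z g a0 a1) (r : R) : a1 (z * r) = a0 r := by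
  have : z * r = algebraMap B R (g * a1 r) + algebraMap B R (a0 r) * z := by
    conv_lhs => rw [h.dec r]
    rw [map_mul, ← h.sq]; ring
  rw [this, h.c1]

theorem Dbl.c0a (h : Dbl B R z g a0 a1) (b : B) : a0 (algebraMap B R b) = b := by
  have := h.c0 b 0
  simpa using this

theorem Dbl.c1a (h : Dbl B R z g a0 a1) (b : B) : a1 (algebraMap B R b) = 0 := by
  have := h.c1 b 0
  simpa using this

variable {M : Type*} [AddCommGroup M] [Module R M] [Module B M] [IsScalarTower B R M]

theorem extend_B (h : Dbl B R z g a0 a1) (σ : R →+* R)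
    (hσB : ∀ b, σ (algebraMap B R b) = algebraMap B R b) (hσz : σ z = -z)
    (Θ : M →+ M) (hΘ2 : ∀ m, Θ (Θ m) = m) (hΘ : ∀ (r : R) m, Θ (r • m) = σ r • Θ m)
    {n : ℕ} (p : (Fin n → B) →ₗ[B] M) (hp : Function.Surjective p)
    (π : (Fin n → R) →ₗ[R] M)
    (hπ : ∀ f, π f = p (fun i => a0 (f i)) + z • p (fun i => a1 (f i)))
    (hrig : ∀ φ : LinearMap.ker π →ₗ[R] M, Ext _ φ)
    (φ : LinearMap.ker p →ₗ[B] M) :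
    ∃ Ψ : (Fin n → R) →ₗ[R] M, ∀ f (hf : p f = 0),
      Ψ (fun i => algebraMap B R (f i)) = φ ⟨f, hf⟩ := by
  classical
  let A0 : (Fin n → R) → (Fin n → B) := fun f i => a0 (f i)
  let A1 : (Fin n → R) → (Fin n → B) := fun f i => a1 (f i)
  have hA0a : ∀ f f', A0 (f + f') = A0 f + A0 f' := fun f f' => by funext i; simp [A0]
  have hA1a : ∀ f f', A1 (f + f') = A1 f + A1 f' := fun f f' => by funext i; simp [A1]
  have hA0s : ∀ f f', A0 (f - f') = A0 f - A0 f' := fun f f' => by funext i; simp [A0]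
  have hA1s : ∀ f f', A1 (f - f') = A1 f - A1 f' := fun f f' => by funext i; simp [A1]
  have hA0z : ∀ f, A0 (z • f) = g • A1 f := fun f => by
    funext i; simp [A0, A1, h.c0z]
  have hA1z : ∀ f, A1 (z • f) = A0 f := fun f => by
    funext i; simp [A0, A1, h.c1z]
  have hA0b : ∀ (b : B) f, A0 (algebraMap B R b • f) = b • A0 f := fun b f => by
    funext i; simp [A0]
  have hA1b : ∀ (b : B) f, A1 (algebraMap B R b • f) = b • A1 f := fun b f => by
    funext i; simp [A1]
  have hzz : ∀ m : M, z • z • m = g • m := fun m => by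
    rw [smul_smul, h.sq, algebraMap_smul]
  have hr : ∀ (r : R) (f : Fin n → R), r • f =
      algebraMap B R (a0 r) • f + algebraMap B R (a1 r) • z • f := fun r f => by
    conv_lhs => rw [h.dec r]
    rw [add_smul, mul_smul]
  have hrm : ∀ (r : R) (f : M), r • f = a0 r • f + a1 r • z • f := fun r f => by
    conv_lhs => rw [h.dec r]
    rw [add_smul, mul_smul, algebraMap_smul, algebraMap_smul]
  have hA0r : ∀ r f, A0 (r • f) = a0 r • A0 f + (a1 r * g) • A1 f := fun r f => by
    rw [hr, hA0a, hA0b, hA0b, hA0z, smul_smul]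
  have hA1r : ∀ r f, A1 (r • f) = a0 r • A1 f + a1 r • A0 f := fun r f => by
    rw [hr, hA1a, hA1b, hA1b, hA1z]
  have hσr : ∀ r, σ r = algebraMap B R (a0 r) - algebraMap B R (a1 r) * z := fun r => by
    conv_lhs => rw [h.dec r]
    rw [map_add, map_mul, hσB, hσB, hσz]; ring
  have hπ' : ∀ f, π f = p (A0 f) + z • p (A1 f) := hπ
  have hπs : Function.Surjective π := by
    intro m
    obtain ⟨f, rfl⟩ := hp m
    refine ⟨fun i => algebraMap B R (f i), ?_⟩
    rw [hπ]
    simp only [h.c0a, h.c1a]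
    change p f + z • p 0 = p f
    simp
  -- the map q
  let q : (Fin n → R) → M := fun f => p (A1 f)
  have hqa : ∀ f f', q (f + f') = q f + q f' := fun f f' => by simp [q, hA1a]
  have hqs : ∀ f f', q (f - f') = q f - q f' := fun f f' => by simp [q, hA1s]
  have hqr : ∀ r f, π f = 0 → q (r • f) = σ r • q f := by
    intro r f hf
    rw [hπ'] at hf
    have h1 : p (A0 f) = - z • p (A1 f) := by rw [neg_smul]; exact eq_neg_of_add_eq_zero_left hf
    simp only [q, hA1r, map_add, map_smul, h1, hσr, sub_smul, mul_smul, algebraMap_smul, neg_smul,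
      smul_neg]
    abel
  have hqsurj : ∀ m, ∃ κ, π κ = 0 ∧ q κ = m := by
    intro m
    obtain ⟨f', rfl⟩ := hp m
    obtain ⟨f, hf⟩ := hp (-(z • p f'))
    refine ⟨fun i => algebraMap B R (f i) + algebraMap B R (f' i) * z, ?_, ?_⟩
    · rw [hπ]; simp only [h.c0, h.c1]; rw [hf]; simp
    · simp only [q, A1, h.c1]
  choose κ hκ0 hκq using fun i : Fin n => hqsurj (Θ (π (Pi.single i 1)))
  let lam : (Fin n → R) →ₗ[R] (Fin n → R) := Fintype.linearCombination R κ
  have hlam0 : ∀ f, π (lam f) = 0 := fun f => by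
    simp [lam, Fintype.linearCombination_apply, hκ0]
  have hlamq : ∀ f, q (lam f) = Θ (π f) := by
    intro f
    let qh : (Fin n → R) →+ M := ⟨⟨q, by simpa [q, hA1s] using hqs 0 0⟩, hqa⟩
    have h1 : q (lam f) = ∑ i, q (f i • κ i) := by
      change qh (lam f) = ∑ i, qh (f i • κ i)
      rw [← map_sum]; rfl
    have h2 : f = ∑ i, f i • (Pi.single i 1 : Fin n → R) := by
      rw [← Fintype.linearCombination_apply]
      funext j
      simp [Fintype.linearCombination_apply, Finset.sum_apply, Pi.single_apply]
    conv_rhs => rw [h2]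
    rw [h1, map_sum, map_sum]
    refine Finset.sum_congr rfl fun i _ => ?_
    rw [hqr _ _ (hκ0 i), hκq, map_smul, hΘ]
  -- φ_R on K2
  let K2 : Submodule R (Fin n → R) :=
    { carrier := {f | p (A0 f) = 0 ∧ p (A1 f) = 0}
      add_mem' := fun {a b} ha hb => by
        simp only [Set.mem_ofPred_eq] at ha hb ⊢
        simp [hA0a, hA1a, ha, hb]
      zero_mem' := by
        have h0 : A0 0 = 0 := by funext i; simp [A0]
        have h1 : A1 0 = 0 := by funext i; simp [A1]
        simp [h0, h1]
      smul_mem' := fun c a ha => by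
        simp only [Set.mem_ofPred_eq] at ha ⊢
        simp [hA0r, hA1r, ha] }
  let φR : K2 →ₗ[R] M :=
    { toFun := fun f => φ ⟨A0 f, f.2.1⟩ + z • φ ⟨A1 f, f.2.2⟩
      map_add' := fun a b => by
        have e0 : (⟨A0 (a + b : K2), (a + b).2.1⟩ : LinearMap.ker p) = ⟨A0 a, a.2.1⟩ + ⟨A0 b, b.2.1⟩ :=
          Subtype.ext (hA0a _ _)
        have e1 : (⟨A1 (a + b : K2), (a + b).2.2⟩ : LinearMap.ker p) = ⟨A1 a, a.2.2⟩ + ⟨A1 b, b.2.2⟩ :=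
          Subtype.ext (hA1a _ _)
        rw [e0, e1, map_add, map_add, smul_add]; abel
      map_smul' := fun r a => by
        have e0 : (⟨A0 (r • a : K2), (r • a).2.1⟩ : LinearMap.ker p) =
            a0 r • ⟨A0 a, a.2.1⟩ + (a1 r * g) • ⟨A1 a, a.2.2⟩ :=
          Subtype.ext (hA0r _ _)
        have e1 : (⟨A1 (r • a : K2), (r • a).2.2⟩ : LinearMap.ker p) =
            a0 r • ⟨A1 a, a.2.2⟩ + a1 r • ⟨A0 a, a.2.1⟩ :=
          Subtype.ext (hA1r _ _)
        rw [e0, e1]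
        simp only [map_add, map_smul, RingHom.id_apply]
        rw [hrm r]
        simp only [smul_add, hzz, mul_smul]
        rw [smul_comm z (a0 r), smul_comm z (a1 r)]
        abel }
  have hK2 : ∀ f, π f = 0 → q f = 0 → f ∈ K2 := by
    intro f hf hq
    refine ⟨?_, hq⟩
    have : p (A1 f) = 0 := hq
    simpa [hπ', this] using hf
  obtain ⟨χ, hχ⟩ := hrig (φR ∘ₗ LinearMap.codRestrict K2 (lam ∘ₗ (LinearMap.ker π).subtype)
    (fun f => hK2 _ (hlam0 _) (by
      have : π f = 0 := f.2
      change q (lam f) = 0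
      rw [hlamq, this, map_zero])))
  have hχ' : ∀ f, π f = 0 → ∀ hl : lam f ∈ K2, χ f = φR ⟨lam f, hl⟩ := fun f hf hl => hχ ⟨f, hf⟩
  choose s hs using fun m => hπs (Θ m)
  have hqls : ∀ f v, π v = Θ (q f) → q (f - lam v) = 0 := fun f v hv => by
    rw [hqs, hlamq, hv, hΘ2, sub_self]
  have hin : ∀ f v, π f = 0 → π v = Θ (q f) → f - lam v ∈ K2 := fun f v hf hv =>
    hK2 _ (by rw [map_sub, hf, hlam0, sub_self]) (hqls f v hv)
  have hlK : ∀ f, π f = 0 → lam f ∈ K2 := fun f hf =>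
    hK2 _ (hlam0 f) (by rw [hlamq, hf, map_zero])
  have hindep : ∀ f v v' (hf : π f = 0) (hv : π v = Θ (q f)) (hv' : π v' = Θ (q f)),
      χ v + φR ⟨f - lam v, hin f v hf hv⟩ = χ v' + φR ⟨f - lam v', hin f v' hf hv'⟩ := by
    intro f v v' hf hv hv'
    have hd : π (v - v') = 0 := by rw [map_sub, hv, hv', sub_self]
    have e := hχ' _ hd (hlK _ hd)
    rw [map_sub] at e
    have e2 : φR ⟨f - lam v', hin f v' hf hv'⟩ =
        φR ⟨f - lam v, hin f v hf hv⟩ + φR ⟨lam (v - v'), hlK _ hd⟩ := by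
      rw [← map_add]; congr 1
      apply Subtype.ext
      simp
    rw [e2, ← e]; abel
  let Φ : LinearMap.ker π →ₗ[R] M :=
    { toFun := fun f => χ (s (q f)) + φR ⟨f - lam (s (q f)), hin f _ f.2 (hs _)⟩
      map_add' := fun a b => by
        have hv : π (s (q a) + s (q b)) = Θ (q (a + b : LinearMap.ker π)) := by
          rw [map_add, hs, hs, ← map_add, ← hqa]; rfl
        rw [hindep _ _ _ (a + b).2 (hs _) hv, map_add]
        have : (⟨(a + b : LinearMap.ker π) - lam (s (q a) + s (q b)), hin _ _ (a + b).2 hv⟩ : K2) =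
          ⟨a - lam (s (q a)), hin a _ a.2 (hs _)⟩ + ⟨b - lam (s (q b)), hin b _ b.2 (hs _)⟩ := by
          apply Subtype.ext
          simp only [map_add, Submodule.coe_add]
          abel
        rw [this, map_add]; abel
      map_smul' := fun r a => by
        have hσσ : ∀ r, σ (σ r) = r := fun r => by
          rw [hσr r, map_sub, map_mul, hσB, hσB, hσz]
          conv_rhs => rw [h.dec r]
          ring
        have hv : π (r • s (q a)) = Θ (q (r • a : LinearMap.ker π)) := by
          have : q (r • a : LinearMap.ker π) = σ r • q a := hqr r a a.2
          rw [map_smul, hs, this, hΘ, hσσ]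
        rw [hindep _ _ _ (r • a).2 (hs _) hv, map_smul]
        have : (⟨(r • a : LinearMap.ker π) - lam (r • s (q a)), hin _ _ (r • a).2 hv⟩ : K2) =
          r • ⟨a - lam (s (q a)), hin a _ a.2 (hs _)⟩ := by
          apply Subtype.ext
          simp only [map_smul, Submodule.coe_smul, smul_sub]
        rw [this, map_smul, smul_add, RingHom.id_apply] }
  obtain ⟨Ψ, hΨ⟩ := hrig Φ
  refine ⟨Ψ, fun f hf => ?_⟩
  let F : Fin n → R := fun i => algebraMap B R (f i)
  have hF0 : A0 F = f := by funext i; simp [A0, F, h.c0a]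
  have hF1 : A1 F = 0 := by funext i; simp [A1, F, h.c1a]
  have hqF : q F = 0 := by simp [q, hF1]
  have hπF : π F = 0 := by rw [hπ', hF0, hF1, hf]; simp
  have e := hΨ ⟨F, hπF⟩
  change Ψ F = _
  rw [e]
  change χ (s (q F)) + φR ⟨F - lam (s (q F)), hin F _ hπF (hs _)⟩ = _
  have h0 : π 0 = Θ (q F) := by rw [hqF, map_zero, map_zero]
  rw [hindep F _ 0 hπF (hs _) h0, map_zero, zero_add]
  have e0 : A0 (F - lam 0) = f := by rw [map_zero, sub_zero, hF0]
  have e1 : A1 (F - lam 0) = 0 := by rw [map_zero, sub_zero, hF1]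
  have e3 : ∀ (u v : LinearMap.ker p), u.1 = f → v.1 = 0 → φ u + z • φ v = φ ⟨f, hf⟩ := by
    intro u v hu hv
    have hv' : v = 0 := Subtype.ext hv
    have hu' : u = ⟨f, hf⟩ := Subtype.ext hu
    rw [hv', hu', map_zero, smul_zero, add_zero]
  exact e3 _ _ e0 e1

theorem proj_of_rigid [IsLocalRing B] [Nontrivial M] [Module.Finite B M]
    (h : Dbl B R z g a0 a1) (σ : R →+* R)
    (hσB : ∀ b, σ (algebraMap B R b) = algebraMap B R b) (hσz : σ z = -z)
    (Θ : M →+ M) (hΘ2 : ∀ m, Θ (Θ m) = m) (hΘ : ∀ (r : R) m, Θ (r • m) = σ r • Θ m)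
    {n : ℕ} (p : (Fin n → B) →ₗ[B] M) (hp : Function.Surjective p)
    (hmin : ∀ v, p v = 0 → ∀ i, v i ∈ IsLocalRing.maximalIdeal B)
    (hfree : Module.Free B (LinearMap.ker p))
    (π : (Fin n → R) →ₗ[R] M)
    (hπ : ∀ f, π f = p (fun i => a0 (f i)) + z • p (fun i => a1 (f i)))
    (hrig : ∀ φ : LinearMap.ker π →ₗ[R] M, Ext _ φ) : Module.Projective R M := by
  classical
  have hker : LinearMap.ker p = ⊥ := by
    by_contra hne
    have hnt : Nontrivial (LinearMap.ker p) := Submodule.nontrivial_iff_ne_bot.2 hne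
    let bs := Module.Free.chooseBasis B (LinearMap.ker p)
    obtain ⟨i0⟩ : Nonempty (Module.Free.ChooseBasisIndex B (LinearMap.ker p)) := bs.index_nonempty
    have hNak : IsLocalRing.maximalIdeal B • (⊤ : Submodule B M) ≠ ⊤ := by
      intro e
      have := Submodule.eq_bot_of_le_smul_of_le_jacobson_bot (IsLocalRing.maximalIdeal B)
        (⊤ : Submodule B M) Module.Finite.fg_top e.ge (IsLocalRing.maximalIdeal_le_jacobson _)
      exact bot_ne_top this.symm
    apply hNak
    rw [eq_top_iff]
    intro m0 _
    obtain ⟨Ψ, hΨ⟩ := extend_B h σ hσB hσz Θ hΘ2 hΘ p hp π hπ hrig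
      ((LinearMap.toSpanSingleton B M m0) ∘ₗ bs.coord i0)
    have h1 := hΨ (bs i0) (bs i0).2
    have h2 : Ψ (fun i => algebraMap B R ((bs i0 : Fin n → B) i)) = m0 := by
      rw [h1]; simp
    rw [← h2]
    have h3 : (fun i => algebraMap B R ((bs i0 : Fin n → B) i)) =
        ∑ i, ((bs i0 : Fin n → B) i) • (Pi.single i 1 : Fin n → R) := by
      funext j
      simp [Finset.sum_apply, Pi.single_apply, Algebra.smul_def]
    rw [h3, map_sum]
    refine Submodule.sum_mem _ fun i _ => ?_
    rw [LinearMap.map_smul_of_tower]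
    exact Submodule.smul_mem_smul (hmin _ (bs i0).2 i) trivial
  have hpinj : ∀ v, p v = 0 → v = 0 := fun v hv => by
    have : v ∈ LinearMap.ker p := hv
    rwa [hker] at this
  have hπs : Function.Surjective π := by
    intro m
    obtain ⟨f, rfl⟩ := hp m
    refine ⟨fun i => algebraMap B R (f i), ?_⟩
    rw [hπ]
    simp only [h.c0a, h.c1a]
    change p f + z • p 0 = p f
    simp
  have hσr : ∀ r, σ r = algebraMap B R (a0 r) - algebraMap B R (a1 r) * z := fun r => by
    conv_lhs => rw [h.dec r]
    rw [map_add, map_mul, hσB, hσB, hσz]; ring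
  have hσσ : ∀ r, σ (σ r) = r := fun r => by
    rw [hσr r, map_sub, map_mul, hσB, hσB, hσz]
    conv_rhs => rw [h.dec r]
    ring
  -- the linear isomorphism Θ q
  have hk : ∀ f : Fin n → R, π f = 0 →
      p (fun i => a0 (f i)) = - z • p (fun i => a1 (f i)) := fun f hf => by
    rw [hπ] at hf
    rw [neg_smul]; exact eq_neg_of_add_eq_zero_left hf
  let Q : LinearMap.ker π →ₗ[R] M :=
    { toFun := fun f => Θ (p (fun i => a1 (f.1 i)))
      map_add' := fun a b => by
        rw [← map_add, ← map_add]; congr 2; funext i; simp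
      map_smul' := fun r a => by
        have : (fun i => a1 ((r • a).1 i)) = a0 r • (fun i => a1 (a.1 i)) +
            a1 r • (fun i => a0 (a.1 i)) := by
          funext i
          have h3 : r * a.1 i = algebraMap B R (a0 r) * a.1 i + algebraMap B R (a1 r) * (z * a.1 i) := by
            conv_lhs => rw [h.dec r]
            ring
          have h4 : a1 (r * a.1 i) = a0 r * a1 (a.1 i) + a1 r * a0 (a.1 i) := by
            rw [h3, map_add, ← Algebra.smul_def, ← Algebra.smul_def, map_smul, map_smul, h.c1z]
            rfl
          simpa using h4
        have e : p (fun i => a1 ((r • a).1 i)) = σ r • p (fun i => a1 (a.1 i)) := by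
          rw [this, map_add, map_smul, map_smul, hk a.1 a.2, hσr, sub_smul, mul_smul,
            algebraMap_smul, algebraMap_smul, neg_smul, smul_neg]
          abel
        rw [e, hΘ, hσσ]; rfl }
  have hQinj : Function.Injective Q := by
    rw [← LinearMap.ker_eq_bot, eq_bot_iff]
    intro f hf
    have h1 : Θ (p (fun i => a1 (f.1 i))) = 0 := hf
    have h2 : p (fun i => a1 (f.1 i)) = 0 := by rw [← hΘ2 (p _), h1, map_zero]
    have h3 := hk f.1 f.2
    rw [h2, smul_zero] at h3
    have h4 := hpinj _ h2
    have h5 := hpinj _ h3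
    apply Subtype.ext
    funext i
    rw [h.dec (f.1 i), congrFun h4 i, congrFun h5 i]
    simp
  have hQs : Function.Surjective Q := by
    intro m
    obtain ⟨f', hf'⟩ := hp (Θ m)
    obtain ⟨f, hf⟩ := hp (-(z • p f'))
    refine ⟨⟨fun i => algebraMap B R (f i) + algebraMap B R (f' i) * z, ?_⟩, ?_⟩
    · rw [LinearMap.mem_ker, hπ]; simp only [h.c0, h.c1]; rw [hf]; simp
    · change Θ (p (fun i => a1 _)) = m
      simp only [h.c1]
      rw [hf', hΘ2]
  let Qe := LinearEquiv.ofBijective Q ⟨hQinj, hQs⟩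
  obtain ⟨ψ, hψ⟩ := hrig Q
  let ret : (Fin n → R) →ₗ[R] (Fin n → R) :=
    LinearMap.id - (LinearMap.ker π).subtype ∘ₗ Qe.symm.toLinearMap ∘ₗ ψ
  have hret : ∀ f, π f = 0 → ret f = 0 := by
    intro f hf
    have h1 : ψ f = Qe ⟨f, hf⟩ := hψ ⟨f, hf⟩
    simp [ret, h1]
  have hπret : ∀ f, π (ret f) = π f := by
    intro f
    have : π ((LinearMap.ker π).subtype (Qe.symm (ψ f))) = 0 := (Qe.symm (ψ f)).2
    simp only [ret, LinearMap.sub_apply, LinearMap.comp_apply, map_sub, LinearMap.id_apply,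
      LinearEquiv.coe_coe]
    rw [this, sub_zero]
  have hle : LinearMap.ker π ≤ LinearMap.ker ret := fun f hf => hret f hf
  refine Module.Projective.of_split
    ((Submodule.liftQ _ ret hle) ∘ₗ (π.quotKerEquivOfSurjective hπs).symm.toLinearMap) π ?_
  ext m
  obtain ⟨f, rfl⟩ := hπs m
  have : (π.quotKerEquivOfSurjective hπs).symm (π f) = Submodule.Quotient.mk f := by
    rw [LinearEquiv.symm_apply_eq]; rfl
  simp [this, hπret]

end split

end CDV




namespace CDV

section gldim

theorem proj_range {A : Type} [Ring A] (hA : FiniteGlobalDimension A) {G : Type} [AddCommGroup G]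
    [Module A G] [Module.Projective A G] (T T' : G →ₗ[A] G)
    (h : LinearMap.range T' = LinearMap.ker T) (h' : LinearMap.range T = LinearMap.ker T') :
    Module.Projective A (LinearMap.range T) ∨ Module.Projective A (LinearMap.range T') := by
  obtain ⟨d, hd⟩ := hA
  have step : ∀ (T T' : G →ₗ[A] G), LinearMap.range T' = LinearMap.ker T → ∀ n : ℕ,
      HasProjectiveDimensionLT (ModuleCat.of A (LinearMap.range T)) (n + 2) →
      HasProjectiveDimensionLT (ModuleCat.of A (LinearMap.range T')) (n + 1) := by
    intro T T' h n hn
    have e0 : T.rangeRestrict.comp (LinearMap.range T').subtype = 0 := by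
      ext ⟨v, hv⟩
      rw [h] at hv
      exact hv
    have hS : (ModuleCat.shortComplexOfCompEqZero _ _ e0).ShortExact := by
      refine ModuleCat.shortComplex_shortExact _ ?_ ?_ ?_
      · intro v
        change T.rangeRestrict v = 0 ↔ v ∈ Set.range (LinearMap.range T').subtype
        have hiff : v ∈ LinearMap.range T' ↔ v ∈ LinearMap.ker T := SetLike.ext_iff.1 h v
        rw [Submodule.coe_subtype, Subtype.range_coe, SetLike.mem_coe]
        refine Iff.trans ?_ hiff.symm
        exact ⟨fun e => congrArg Subtype.val e, fun e => Subtype.ext e⟩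
      · exact Subtype.val_injective
      · exact T.surjective_rangeRestrict
    have hG : Projective (ModuleCat.of A G) := (IsProjective.iff_projective G).1 inferInstance
    exact (hS.hasProjectiveDimensionLT_X₃_iff n hG).1 hn
  have main : ∀ n : ℕ, (HasProjectiveDimensionLT (ModuleCat.of A (LinearMap.range T)) (n + 1) ∨
      HasProjectiveDimensionLT (ModuleCat.of A (LinearMap.range T')) (n + 1)) →
      Module.Projective A (LinearMap.range T) ∨ Module.Projective A (LinearMap.range T') := by
    intro n
    induction n with
    | zero =>
      rintro (h0 | h0)
      · left
        exact (IsProjective.iff_projective _).2 (projective_iff_hasProjectiveDimensionLT_one.2 h0)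
      · right
        exact (IsProjective.iff_projective _).2 (projective_iff_hasProjectiveDimensionLT_one.2 h0)
    | succ n ih =>
      rintro (h0 | h0)
      · exact ih (Or.inr (step T T' h n h0))
      · exact ih (Or.inl (step T' T h' n h0))
  refine main d (Or.inl ?_)
  rw [hasProjectiveDimensionLT_iff]
  intro i hi Y e
  have := hd (ModuleCat.of A (LinearMap.range T)) Y i (by omega)
  exact Subsingleton.elim _ _

variable {R : Type} [CommRing R] [IsLocalRing R] {A : Type} [Ring A] [Algebra R A]
  {G : Type} [AddCommGroup G] [Module R G] [Module A G] [IsScalarTower R A G]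

theorem zero_of_proj [IsNoetherian R G] (T T' : G →ₗ[A] G)
    (h : LinearMap.range T' = LinearMap.ker T)
    (hm : ∀ v, T' v ∈ IsLocalRing.maximalIdeal R • (⊤ : Submodule R G))
    (hp : Module.Projective A (LinearMap.range T)) : T' = 0 := by
  obtain ⟨s, hs⟩ := Module.projective_lifting_property T.rangeRestrict LinearMap.id
    T.surjective_rangeRestrict
  have hs' : ∀ v, T (s v) = v := fun v => congrArg Subtype.val (LinearMap.congr_fun hs v)
  let E : G →ₗ[R] G := (LinearMap.id - s ∘ₗ T.rangeRestrict).restrictScalars R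
  have hE : ∀ v, T v = 0 → E v = v := by
    intro v hv
    have : T.rangeRestrict v = 0 := Subtype.ext hv
    simp [E, this]
  let W : Submodule R G := LinearMap.ker (T.restrictScalars R)
  have hEW : ∀ v, E v ∈ W := by
    intro v
    simp only [W, LinearMap.mem_ker, LinearMap.restrictScalars_apply, E, LinearMap.sub_apply,
      LinearMap.id_apply, LinearMap.comp_apply, map_sub, hs']
    simp
  have hW : W ≤ IsLocalRing.maximalIdeal R • W := by
    intro v hv
    have hv0 : T v = 0 := hv
    have h1 : v ∈ LinearMap.range T' := by rw [h]; exact hv0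
    obtain ⟨u, rfl⟩ := h1
    rw [← hE _ hv0]
    have := Submodule.mem_map_of_mem (f := E) (hm u)
    rw [Submodule.map_smul''] at this
    refine Submodule.smul_mono le_rfl ?_ this
    rintro _ ⟨w, -, rfl⟩
    exact hEW w
  have hbot : W = ⊥ := Submodule.eq_bot_of_le_smul_of_le_jacobson_bot _ _
    (IsNoetherian.noetherian _) hW (IsLocalRing.maximalIdeal_le_jacobson _)
  ext v
  have : T' v ∈ W := by
    have : T' v ∈ LinearMap.ker T := by rw [← h]; exact ⟨v, rfl⟩
    exact this
  rw [hbot] at this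
  exact this

theorem not_finite_gldim [IsNoetherianRing R] {B : Type*} [CommRing B] [Algebra B R] {z : R} {g : B}
    {a0 a1 : R →ₗ[B] B} (h : Dbl B R z g a0 a1) [Nontrivial B]
    {M : Type} [AddCommGroup M] [Module R M] [Module.Finite R M] [Module.Free R M] [Nontrivial M]
    {n : ℕ} (hn : 0 < n) (φ : Matrix (Fin n) (Fin n) B)
    (hφ : φ * φ = g • (1 : Matrix (Fin n) (Fin n) B))
    (hz : z ∈ IsLocalRing.maximalIdeal R)
    (hφm : ∀ i j, algebraMap B R (φ i j) ∈ IsLocalRing.maximalIdeal R) :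
    ¬ FiniteGlobalDimension (Module.End R M) := by
  classical
  intro hgd
  -- M is projective over its endomorphism ring
  let bs := Module.Free.chooseBasis R M
  obtain ⟨i0⟩ : Nonempty (Module.Free.ChooseBasisIndex R M) := bs.index_nonempty
  have hproj : Module.Projective (Module.End R M) (Fin n → M) := by
    let i1 : (Fin n → M) →ₗ[Module.End R M] (Fin n → Module.End R M) :=
      { toFun := fun v i => LinearMap.toSpanSingleton R M (v i) ∘ₗ bs.coord i0
        map_add' := fun v w => by funext i; ext m; simp
        map_smul' := fun a v => by funext i; ext m; simp }
    let s1 : (Fin n → Module.End R M) →ₗ[Module.End R M] (Fin n → M) :=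
      { toFun := fun v i => v i (bs i0)
        map_add' := fun v w => by funext i; simp
        map_smul' := fun a v => by funext i; simp }
    refine Module.Projective.of_split i1 s1 ?_
    ext v i
    simp [i1, s1]
  -- the maps
  let S : R → (Fin n → M) →ₗ[Module.End R M] (Fin n → M) := fun ε =>
    { toFun := fun v i => z • v i + ε • ∑ j, algebraMap B R (φ i j) • v j
      map_add' := fun v w => by
        funext i; simp only [Pi.add_apply, smul_add, Finset.sum_add_distrib]; abel
      map_smul' := fun a v => by
        funext i
        simp [map_sum] }
  have hS : ∀ ε v i, S ε v i = z • v i + ε • ∑ j, algebraMap B R (φ i j) • v j :=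
    fun _ _ _ => rfl
  have hφφ : ∀ i j, ∑ l, φ i l * φ l j = if i = j then g else 0 := by
    intro i j
    have := congrFun (congrFun hφ i) j
    rw [Matrix.mul_apply] at this
    rw [this]
    simp [Matrix.one_apply]
  have hφφM : ∀ (v : Fin n → M) i, ∑ l, algebraMap B R (φ i l) • ∑ j, algebraMap B R (φ l j) • v j
      = algebraMap B R g • v i := by
    intro v i
    simp only [Finset.smul_sum, smul_smul, ← map_mul]
    rw [Finset.sum_comm]
    simp only [← Finset.sum_smul, ← map_sum, hφφ]
    simp [ite_smul, apply_ite (algebraMap B R)]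
  have hcomp : ∀ ε : R, ε * ε = 1 → ∀ v, S ε (S (-ε) v) = 0 := by
    intro ε hε v
    funext i
    rw [hS]
    simp only [hS, smul_add, Finset.sum_add_distrib, smul_smul, h.sq]
    have e1 : ∑ x, ((algebraMap B R) (φ i x) * -ε) • ∑ j, (algebraMap B R) (φ x j) • v j =
        -ε • algebraMap B R g • v i := by
      rw [← hφφM, Finset.smul_sum]
      refine Finset.sum_congr rfl fun x _ => ?_
      rw [mul_comm, mul_smul]
    have e2 : ∑ x, ((algebraMap B R) (φ i x) * z) • v x =
        z • ∑ j, (algebraMap B R) (φ i j) • v j := by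
      rw [Finset.smul_sum]
      refine Finset.sum_congr rfl fun x _ => ?_
      rw [mul_comm, mul_smul]
    rw [e1, e2]
    simp only [smul_smul, Pi.zero_apply]
    have e3 : ε * (-ε * algebraMap B R g) = - algebraMap B R g := by
      rw [← mul_assoc, mul_neg, hε]; ring
    rw [e3, mul_comm z (-ε)]
    simp only [neg_smul, neg_mul]
    abel
  have hexR : ∀ ε : B, ε * ε = 1 → ∀ r : Fin n → R,
      (∀ i, z * r i + algebraMap B R ε * ∑ j, algebraMap B R (φ i j) * r j = 0) →
      ∃ q : Fin n → R,
        ∀ i, r i = z * q i + (-algebraMap B R ε) * ∑ j, algebraMap B R (φ i j) * q j := by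
    intro ε hε r hr
    refine ⟨fun i => algebraMap B R (a1 (r i)), fun i => ?_⟩
    have e1 := congrArg a1 (hr i)
    rw [map_add, h.c1z, ← Algebra.smul_def, map_smul, map_sum, map_zero] at e1
    have e2 : ∀ j, a1 (algebraMap B R (φ i j) * r j) = φ i j * a1 (r j) := fun j => by
      rw [← Algebra.smul_def, map_smul, smul_eq_mul]
    simp only [e2, smul_eq_mul] at e1
    conv_lhs => rw [h.dec (r i)]
    rw [eq_neg_of_add_eq_zero_left e1]
    simp only [map_neg, map_mul, map_sum]
    ring
  have hex : ∀ ε : B, ε * ε = 1 →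
      LinearMap.range (S (-algebraMap B R ε)) = LinearMap.ker (S (algebraMap B R ε)) := by
    intro ε hε
    apply le_antisymm
    · rintro _ ⟨v, rfl⟩
      exact hcomp _ (by rw [← map_mul, hε, map_one]) v
    · intro v hv
      have hv0 : S (algebraMap B R ε) v = 0 := hv
      have h1 : ∀ l, ∃ q : Fin n → R, ∀ i, bs.repr (v i) l =
          z * q i + (-algebraMap B R ε) * ∑ j, algebraMap B R (φ i j) * q j := by
        intro l
        refine hexR ε hε _ fun i => ?_
        have h2 := congrFun hv0 i
        rw [hS] at h2
        have h3 := congrArg (fun m => bs.repr m l) h2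
        simpa [Algebra.smul_def] using h3
      choose q hq using h1
      refine ⟨fun i => ∑ l, q l i • bs l, ?_⟩
      funext i
      rw [hS]
      apply bs.ext_elem
      intro l
      rw [hq]
      simp [Finsupp.single_apply, Algebra.smul_def]
  have hmem : ∀ ε v, S ε v ∈ IsLocalRing.maximalIdeal R • (⊤ : Submodule R (Fin n → M)) := by
    intro ε v
    have : S ε v = z • v + ∑ i, ∑ j, (algebraMap B R (φ i j)) • ε • (Pi.single i (v j) : Fin n → M) := by
      funext i
      rw [hS]
      simp [Finset.sum_apply, Pi.single_apply, Finset.smul_sum, smul_comm ε]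
    rw [this]
    refine Submodule.add_mem _ (Submodule.smul_mem_smul hz trivial) ?_
    exact Submodule.sum_mem _ fun i _ => Submodule.sum_mem _ fun j _ =>
      Submodule.smul_mem_smul (hφm i j) trivial
  have hne : ∀ ε : B, S (algebraMap B R ε) ≠ 0 := by
    intro ε he
    let i1 : Fin n := ⟨0, hn⟩
    have h1 := congrFun (LinearMap.congr_fun he (Pi.single i1 (bs i0))) i1
    rw [hS] at h1
    have h2 := congrArg (fun m => bs.repr m i0) h1
    have h3 : z + algebraMap B R ε * algebraMap B R (φ i1 i1) = 0 := by
      simpa [Pi.single_apply, Algebra.smul_def] using h2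
    have h4 := h.c1 (ε * φ i1 i1) 1
    have h5 : algebraMap B R (ε * φ i1 i1) + algebraMap B R 1 * z = 0 := by
      rw [← h3, map_mul, map_one]; ring
    rw [h5, map_zero] at h4
    exact zero_ne_one h4
  have hA1 := hex 1 (by ring)
  have hA2 := hex (-1) (by ring)
  rw [map_neg, neg_neg] at hA2
  rcases proj_range hgd _ _ hA1 hA2 with hp | hp
  · have := zero_of_proj (R := R) _ _ hA1 (hmem _) hp
    exact hne (-1) (by rw [map_neg]; exact this)
  · have := zero_of_proj (R := R) _ _ hA2 (hmem _) hp
    exact hne 1 this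

end gldim

end CDV




namespace CDV

section power_series

variable {k : Type} [Field k]

theorem coeff_X_mul_shift {σ : Type*} (s : σ) (m : σ →₀ ℕ) (w : MvPowerSeries σ k) :
    coeff (Finsupp.single s 1 + m) (X s * w) = coeff m w := by
  rw [X, coeff_add_monomial_mul, one_mul]

theorem coeff_X_mul_zero {σ : Type*} (s : σ) (m : σ →₀ ℕ) (w : MvPowerSeries σ k) (h : m s = 0) :
    coeff m (X s * w) = 0 := by
  have := (X_dvd_iff (s := s) (φ := X s * w)).1 (dvd_mul_right _ _)
  exact this m h

theorem reg3_X {σ : Type*} {j a c : σ} (hja : j ≠ a) (hjc : j ≠ c) (hac : a ≠ c) :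
    Reg3 (X j : MvPowerSeries σ k) (X a) (X c) (MvPowerSeries σ k) := by
  classical
  refine ⟨?_, ?_, ?_⟩
  · intro w h
    ext m
    have := congrArg (coeff (Finsupp.single j 1 + m)) h
    simpa [coeff_X_mul_shift] using this
  · intro w w' h
    have h1 : X j ∣ w := by
      rw [X_dvd_iff]
      intro m hm
      rw [← coeff_X_mul_shift a, ← smul_eq_mul, h, smul_eq_mul, coeff_X_mul_zero]
      simp [hm, hja.symm]
    obtain ⟨v, hv⟩ := h1
    exact ⟨v, hv⟩
  · intro w w1 w2 h
    have key : ∀ m : σ →₀ ℕ, m j = 0 → m a = 0 → coeff m w = 0 := by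
      intro m h1 h2
      rw [← coeff_X_mul_shift c, ← smul_eq_mul, h, smul_eq_mul, smul_eq_mul, map_add,
        coeff_X_mul_zero, coeff_X_mul_zero, add_zero]
      · simp [h2, hac.symm]
      · simp [h1, hjc.symm]
    let w' : MvPowerSeries σ k := fun m => if m a = 0 then coeff m w else 0
    have hw' : ∀ m, coeff m w' = if m a = 0 then coeff m w else 0 := fun m => rfl
    have h1 : X j ∣ w' := by
      rw [X_dvd_iff]
      intro m hm
      rw [hw']
      split_ifs with h2
      · exact key m hm h2
      · rfl
    have h2 : X a ∣ w - w' := by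
      rw [X_dvd_iff]
      intro m hm
      rw [map_sub, hw', if_pos hm, sub_self]
    obtain ⟨v1, hv1⟩ := h1
    obtain ⟨v2, hv2⟩ := h2
    refine ⟨v1, v2, ?_⟩
    rw [smul_eq_mul, smul_eq_mul, ← hv1, ← hv2]
    ring

theorem exists_decomp (n : ℕ) (r : MvPowerSeries (Fin n) k) :
    ∃ (c : k) (q : Fin n → MvPowerSeries (Fin n) k), r = C c + ∑ i, X i * q i := by
  induction n with
  | zero =>
    refine ⟨constantCoeff r, 0, ?_⟩
    ext m
    rw [Subsingleton.elim m 0]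
    simp
  | succ n ih =>
    let e := finSuccEquiv k n
    obtain ⟨c, q, hq⟩ := ih (PowerSeries.constantCoeff (e r))
    refine ⟨c, Fin.cons (e.symm (PowerSeries.mk fun p => PowerSeries.coeff (p + 1) (e r)))
      (fun j => e.symm (PowerSeries.C (q j))), ?_⟩
    apply e.injective
    have h0 := PowerSeries.eq_X_mul_shift_add_const (e r)
    generalize PowerSeries.mk (fun p => PowerSeries.coeff (p + 1) (e r)) = T at h0 ⊢
    rw [h0, hq, Fin.sum_univ_succ]
    simp only [map_add, map_sum, map_mul, Fin.cons_zero, Fin.cons_succ, AlgEquiv.apply_symm_apply]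
    simp only [e, finSuccEquiv_X_zero, finSuccEquiv_X_succ, finSuccEquiv_C]
    ring

theorem maximalIdeal_eq (n : ℕ) :
    IsLocalRing.maximalIdeal (MvPowerSeries (Fin n) k) = Ideal.span (Set.range X) := by
  have hX : Ideal.span (Set.range X) ≤ IsLocalRing.maximalIdeal (MvPowerSeries (Fin n) k) := by
    rw [Ideal.span_le]
    rintro _ ⟨i, rfl⟩
    simp [isUnit_iff_constantCoeff]
  apply le_antisymm _ hX
  intro r hr
  obtain ⟨c, q, hq⟩ := exists_decomp n r
  have h1 : (∑ i, X i * q i) ∈ Ideal.span (Set.range (X : Fin n → MvPowerSeries (Fin n) k)) :=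
    Ideal.sum_mem _ fun i _ => Ideal.mul_mem_right _ _ (Ideal.subset_span ⟨i, rfl⟩)
  have h2 : (C c : MvPowerSeries (Fin n) k) ∈ IsLocalRing.maximalIdeal _ := by
    have := sub_mem hr (hX h1)
    rwa [hq, add_sub_cancel_right] at this
  have h3 : c = 0 := by
    simpa [isUnit_iff_constantCoeff] using h2
  rw [hq, h3, map_zero, zero_add]
  exact h1

theorem maximalIdeal_three {j a c : Fin 3} (hja : j ≠ a) (hjc : j ≠ c) (hac : a ≠ c) :
    IsLocalRing.maximalIdeal (MvPowerSeries (Fin 3) k) = Ideal.span {X j, X a, X c} := by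
  rw [maximalIdeal_eq]
  congr 1
  ext r
  simp only [Set.mem_range, Set.mem_insert_iff, Set.mem_singleton_iff]
  constructor
  · rintro ⟨i, rfl⟩
    have : i = j ∨ i = a ∨ i = c := by omega
    rcases this with h | h | h <;> simp [h]
  · rintro (h | h | h) <;> exact ⟨_, h.symm⟩

/-- Weierstrass division by `X ^ 2 - g`. -/
theorem weier {n : ℕ} (g : MvPowerSeries (Fin n) k) (hg : g ∈ IsLocalRing.maximalIdeal _) :
    (∀ F : PowerSeries (MvPowerSeries (Fin n) k), ∃ q a b,
      F = (PowerSeries.X ^ 2 - PowerSeries.C g) * q + (PowerSeries.C a + PowerSeries.C b * PowerSeries.X)) ∧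
    (∀ q a b, (PowerSeries.X ^ 2 - PowerSeries.C g) * q = PowerSeries.C a + PowerSeries.C b * PowerSeries.X
      → a = 0 ∧ b = 0) := by
  have : IsAdicComplete (IsLocalRing.maximalIdeal (MvPowerSeries (Fin n) k))
      (MvPowerSeries (Fin n) k) := by
    rw [maximalIdeal_eq]; infer_instance
  let G : Polynomial (MvPowerSeries (Fin n) k) := Polynomial.X ^ 2 - Polynomial.C g
  have hmon : G.Monic := Polynomial.monic_X_pow_sub_C g (by norm_num)
  have hdeg : G.natDegree = 2 := Polynomial.natDegree_X_pow_sub_C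
  have hG : G.IsDistinguishedAt (IsLocalRing.maximalIdeal _) := by
    refine ⟨⟨?_⟩, hmon⟩
    intro i hi
    rw [hdeg] at hi
    interval_cases i
    · simpa [G] using hg
    · simp [G, Polynomial.coeff_X_pow]
  have hW := hG.isWeierstrassDivisorAt (Ideal.IsPrime.ne_top inferInstance)
  have hcoe : (G : PowerSeries (MvPowerSeries (Fin n) k)) = PowerSeries.X ^ 2 - PowerSeries.C g := by
    simp [G]
  have hord : ((G : PowerSeries (MvPowerSeries (Fin n) k)).map
      (Ideal.Quotient.mk (IsLocalRing.maximalIdeal _))).order.toNat = 2 := by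
    have : (G : PowerSeries (MvPowerSeries (Fin n) k)).map
      (Ideal.Quotient.mk (IsLocalRing.maximalIdeal _)) = PowerSeries.X ^ 2 := by
      rw [hcoe, map_sub, map_pow, PowerSeries.map_X, PowerSeries.map_C,
        Ideal.Quotient.eq_zero_iff_mem.2 hg, map_zero, sub_zero]
    rw [this, PowerSeries.order_X_pow]
    rfl
  constructor
  · intro F
    have h := hW.isWeierstrassDivisionAt_div_mod F
    have hd := h.degree_lt
    have he := h.eq_mul_add
    rw [hord] at hd
    obtain ⟨a, b, hab⟩ := Polynomial.exists_eq_X_add_C_of_natDegree_le_one (p := hW.mod F)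
      (Polynomial.natDegree_le_of_degree_le (Order.lt_succ_iff.1 hd))
    refine ⟨hW.div F, b, a, he.trans ?_⟩
    rw [hab]
    generalize hW.div F = T
    rw [hcoe]
    simp
    ring
  · intro q a b h
    have h2 := hW.eq_zero_of_mul_eq (q := q)
      (r := Polynomial.C b * Polynomial.X + Polynomial.C a) ?_ ?_
    · have h3 := h2.2
      constructor
      · simpa using congrArg (fun p => Polynomial.coeff p 0) h3
      · simpa using congrArg (fun p => Polynomial.coeff p 1) h3
    · rw [hord]
      exact lt_of_le_of_lt Polynomial.degree_linear_le (by norm_num)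
    · rw [hcoe, h]
      simp
      ring

end power_series

end CDV




namespace CDV

section dbl_gen

variable {B R : Type*} [CommRing B] [CommRing R] [Algebra B R] {z : R} {g : B}

theorem dbl_of (hsq : z * z = algebraMap B R g)
    (hex : ∀ r : R, ∃ a b, r = algebraMap B R a + algebraMap B R b * z)
    (hun : ∀ a b, algebraMap B R a + algebraMap B R b * z = 0 → a = 0 ∧ b = 0) :
    ∃ a0 a1 : R →ₗ[B] B, Dbl B R z g a0 a1 := by
  have hun' : ∀ a b c d, algebraMap B R a + algebraMap B R b * z =
      algebraMap B R c + algebraMap B R d * z → a = c ∧ b = d := by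
    intro a b c d h
    have := hun (a - c) (b - d) (by rw [map_sub, map_sub]; linear_combination h)
    exact ⟨sub_eq_zero.1 this.1, sub_eq_zero.1 this.2⟩
  choose f0 f1 hf using hex
  have hadd : ∀ r s, f0 (r + s) = f0 r + f0 s ∧ f1 (r + s) = f1 r + f1 s := by
    intro r s
    apply hun'
    rw [← hf, map_add, map_add]
    conv_lhs => rw [hf r, hf s]
    ring
  have hsm : ∀ (c : B) r, f0 (c • r) = c • f0 r ∧ f1 (c • r) = c • f1 r := by
    intro c r
    apply hun'
    rw [← hf, smul_eq_mul, smul_eq_mul, map_mul, map_mul, Algebra.smul_def]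
    conv_lhs => rw [hf r]
    ring
  refine ⟨⟨⟨f0, fun r s => (hadd r s).1⟩, fun c r => (hsm c r).1⟩,
    ⟨⟨f1, fun r s => (hadd r s).2⟩, fun c r => (hsm c r).2⟩, ⟨hsq, hf, ?_, ?_⟩⟩
  · intro a b
    exact (hun' _ _ _ _ (hf (algebraMap B R a + algebraMap B R b * z)).symm).1
  · intro a b
    exact (hun' _ _ _ _ (hf (algebraMap B R a + algebraMap B R b * z)).symm).2

variable {a0 a1 : R →ₗ[B] B}

theorem Dbl.exists_equiv (h : Dbl B R z g a0 a1) : Nonempty (R ≃ₗ[B] (B × B)) := by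
  refine ⟨LinearEquiv.ofBijective (a0.prod a1) ⟨?_, ?_⟩⟩
  · intro r s hrs
    have h0 : a0 r = a0 s := congrArg Prod.fst hrs
    have h1 : a1 r = a1 s := congrArg Prod.snd hrs
    rw [h.dec r, h.dec s, h0, h1]
  · rintro ⟨a, b⟩
    exact ⟨algebraMap B R a + algebraMap B R b * z, Prod.ext (h.c0 a b) (h.c1 a b)⟩

theorem Dbl.free (h : Dbl B R z g a0 a1) : Module.Free B R := by
  obtain ⟨e⟩ := h.exists_equiv
  exact Module.Free.of_equiv e.symm

theorem Dbl.finite (h : Dbl B R z g a0 a1) : Module.Finite B R := by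
  obtain ⟨e⟩ := h.exists_equiv
  exact Module.Finite.equiv e.symm

end dbl_gen

section concrete

variable (k : Type) [Field k] (b : ℕ)

/-- The base ring. -/
abbrev BB : Type := MvPowerSeries (Fin 3) k

/-- The right-hand side of the double cover. -/
noncomputable def gB : BB k := X 2 ^ (2 * b + 1) - X 0 ^ 2 - X 1 ^ 2

/-- Single out the `i`-th variable. -/
noncomputable def EE (i : Fin 4) : MvPowerSeries (Fin 4) k ≃ₐ[k] PowerSeries (BB k) :=
  (renameEquiv k (Fin.cycleRange i)).trans (finSuccEquiv k 3)

variable {k} in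
theorem EE_self (i : Fin 4) : EE k i (X i) = PowerSeries.X := by
  have : (renameEquiv k (Fin.cycleRange i)) (X i) = X 0 := by
    rw [← Fin.cycleRange_self i]; exact rename_X _ _
  rw [EE, AlgEquiv.trans_apply, this, finSuccEquiv_X_zero]

variable {k} in
theorem EE_succAbove (i : Fin 4) (j : Fin 3) :
    EE k i (X (i.succAbove j)) = PowerSeries.C (X j) := by
  have : (renameEquiv k (Fin.cycleRange i)) (X (i.succAbove j)) = X j.succ := by
    rw [← Fin.cycleRange_succAbove i]; exact rename_X _ _
  rw [EE, AlgEquiv.trans_apply, this, finSuccEquiv_X_succ]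

variable {k} in
theorem EE_C (i : Fin 4) (c : k) : EE k i (C c) = PowerSeries.C (C c) := by
  have : (renameEquiv k (Fin.cycleRange i)) (C c) = C c := rename_C _ _
  rw [EE, AlgEquiv.trans_apply, this, finSuccEquiv_C]

theorem EE_eqn (i : Fin 4) (hi : i ≠ 3) :
    EE k i (cDVeqn k b) = PowerSeries.X ^ 2 - PowerSeries.C (gB k b) := by
  have h := EE_self (k := k) i
  have h0 := EE_succAbove (k := k) i 0
  have h1 := EE_succAbove (k := k) i 1
  have h2 := EE_succAbove (k := k) i 2
  simp only [cDVeqn, gB, map_add, map_sub, map_pow]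
  rw [← h, ← h0, ← h1, ← h2]
  obtain rfl | rfl | rfl : i = 0 ∨ i = 1 ∨ i = 2 := by omega
  · rw [show Fin.succAbove (0 : Fin 4) 0 = 1 from rfl, show Fin.succAbove (0 : Fin 4) 1 = 2 from rfl,
      show Fin.succAbove (0 : Fin 4) 2 = 3 from rfl]
    ring
  · rw [show Fin.succAbove (1 : Fin 4) 0 = 0 from rfl, show Fin.succAbove (1 : Fin 4) 1 = 2 from rfl,
      show Fin.succAbove (1 : Fin 4) 2 = 3 from rfl]
    ring
  · rw [show Fin.succAbove (2 : Fin 4) 0 = 0 from rfl, show Fin.succAbove (2 : Fin 4) 1 = 1 from rfl,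
      show Fin.succAbove (2 : Fin 4) 2 = 3 from rfl]
    ring

/-- The classes of the variables. -/
noncomputable def xx (i : Fin 4) : cDVring k b := Ideal.Quotient.mk _ (X i)

/-- The structure map `B → R` omitting the `i`-th variable. -/
noncomputable def jmap (i : Fin 4) : BB k →+* cDVring k b :=
  (Ideal.Quotient.mk _).comp ((EE k i).symm.toRingEquiv.toRingHom.comp PowerSeries.C)

theorem jmap_apply (i : Fin 4) (r : BB k) :
    jmap k b i r = Ideal.Quotient.mk _ ((EE k i).symm (PowerSeries.C r)) := rfl

theorem jmap_X (i : Fin 4) (j : Fin 3) : jmap k b i (X j) = xx k b (i.succAbove j) := by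
  rw [jmap_apply, ← EE_succAbove, AlgEquiv.symm_apply_apply, xx]

theorem jmap_C (i : Fin 4) (c : k) : jmap k b i (C c) = algebraMap k (cDVring k b) c := by
  rw [jmap_apply, ← EE_C, AlgEquiv.symm_apply_apply]
  rfl

theorem gB_mem : gB k b ∈ IsLocalRing.maximalIdeal (BB k) := by
  simp [gB, isUnit_iff_constantCoeff]

theorem dbl_exists (i : Fin 4) (hi : i ≠ 3) :
    letI := (jmap k b i).toAlgebra
    ∃ a0 a1 : cDVring k b →ₗ[BB k] BB k, Dbl (BB k) (cDVring k b) (xx k b i) (gB k b) a0 a1 := by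
  letI := (jmap k b i).toAlgebra
  have hmap : ∀ a c : BB k, algebraMap (BB k) (cDVring k b) a + algebraMap _ _ c * xx k b i =
      Ideal.Quotient.mk _ ((EE k i).symm (PowerSeries.C a + PowerSeries.C c * PowerSeries.X)) := by
    intro a c
    rw [map_add, map_mul, map_add, map_mul, ← EE_self i, AlgEquiv.symm_apply_apply]
    rfl
  obtain ⟨hW1, hW2⟩ := weier (gB k b) (gB_mem k b)
  apply dbl_of
  · have h1 : algebraMap (BB k) (cDVring k b) (gB k b) =
      Ideal.Quotient.mk _ ((EE k i).symm (PowerSeries.C (gB k b))) := rfl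
    rw [h1, xx, ← map_mul, Ideal.Quotient.eq, Ideal.mem_span_singleton]
    apply dvd_of_eq
    apply (EE k i).injective
    rw [EE_eqn k b i hi, map_sub, map_mul, EE_self, AlgEquiv.apply_symm_apply]
    ring
  · intro r
    obtain ⟨r, rfl⟩ := Ideal.Quotient.mk_surjective r
    obtain ⟨q, a, c, h⟩ := hW1 (EE k i r)
    refine ⟨a, c, ?_⟩
    rw [hmap, Ideal.Quotient.eq, Ideal.mem_span_singleton]
    refine ⟨(EE k i).symm q, ?_⟩
    apply (EE k i).injective
    rw [map_mul, EE_eqn k b i hi, map_sub, AlgEquiv.apply_symm_apply, AlgEquiv.apply_symm_apply, h]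
    ring
  · intro a c h
    rw [hmap, Ideal.Quotient.eq_zero_iff_mem, Ideal.mem_span_singleton] at h
    obtain ⟨q, hq⟩ := h
    have := congrArg (EE k i) hq
    rw [map_mul, EE_eqn k b i hi, AlgEquiv.apply_symm_apply] at this
    exact hW2 _ _ _ this.symm

end concrete

end CDV




namespace CDV

theorem precomplete_finite {P : Type*} [CommRing P] (I : Ideal P) [IsPrecomplete I P]
    (M : Type*) [AddCommGroup M] [Module P M] [Module.Finite P M] : IsPrecomplete I M := by
  rw [← AdicCompletion.of_surjective_iff]
  intro y
  obtain ⟨t, rfl⟩ := AdicCompletion.ofTensorProduct_surjective_of_finite I M y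
  induction t with
  | zero => exact ⟨0, by simp⟩
  | add a b ha hb =>
    obtain ⟨u, hu⟩ := ha
    obtain ⟨v, hv⟩ := hb
    exact ⟨u + v, by rw [map_add, map_add, hu, hv]⟩
  | tmul r m =>
    obtain ⟨s, rfl⟩ := AdicCompletion.of_surjective I P r
    refine ⟨s • m, ?_⟩
    rw [AdicCompletion.ofTensorProduct_tmul]
    ext n
    simp
    rfl

section concrete

variable (k : Type) [Field k] (b : ℕ)

theorem eqn_mem : cDVeqn k b ∈ IsLocalRing.maximalIdeal (MvPowerSeries (Fin 4) k) := by
  simp [cDVeqn, isUnit_iff_constantCoeff]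

instance nontrivialR : Nontrivial (cDVring k b) := by
  apply Ideal.Quotient.nontrivial_iff.2
  intro h
  have := (Ideal.span_singleton_le_iff_mem _).2 (eqn_mem k b)
  rw [h] at this
  exact Ideal.IsPrime.ne_top inferInstance (top_le_iff.1 this)

instance localR : IsLocalRing (cDVring k b) :=
  IsLocalRing.of_surjective' (Ideal.Quotient.mk _) Ideal.Quotient.mk_surjective

theorem xx_mem (i : Fin 4) : xx k b i ∈ IsLocalRing.maximalIdeal (cDVring k b) := by
  rw [IsLocalRing.mem_maximalIdeal, mem_nonunits_iff]
  intro h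
  have : IsLocalHom (Ideal.Quotient.mk (Ideal.span {cDVeqn k b})) :=
    IsLocalHom.of_surjective _ Ideal.Quotient.mk_surjective
  have h2 := isUnit_of_map_unit _ _ h
  simp [isUnit_iff_constantCoeff] at h2

theorem gen_xx (r : cDVring k b) : ∃ (c : k) (q : Fin 4 → cDVring k b),
    r = algebraMap k (cDVring k b) c + ∑ i, xx k b i * q i := by
  obtain ⟨r, rfl⟩ := Ideal.Quotient.mk_surjective r
  obtain ⟨c, q, hq⟩ := exists_decomp 4 r
  refine ⟨c, fun i => Ideal.Quotient.mk _ (q i), ?_⟩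
  rw [hq, map_add, map_sum]
  simp only [map_mul]
  rfl

theorem maximalIdeal_map : (Ideal.span (Set.range (X : Fin 4 → MvPowerSeries (Fin 4) k))).map
    (Ideal.Quotient.mk (Ideal.span {cDVeqn k b})) = IsLocalRing.maximalIdeal (cDVring k b) := by
  have h := IsLocalRing.eq_maximalIdeal (R := cDVring k b)
    (I := (IsLocalRing.maximalIdeal (MvPowerSeries (Fin 4) k)).map
    (Ideal.Quotient.mk (Ideal.span {cDVeqn k b}))) ?_
  · rw [← h, maximalIdeal_eq]
  · apply (Ideal.map_eq_top_or_isMaximal_of_surjective _ Ideal.Quotient.mk_surjective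
      inferInstance).resolve_left
    rw [maximalIdeal_eq, Ideal.map_span]
    intro h
    have : Ideal.span (Set.image (Ideal.Quotient.mk (Ideal.span {cDVeqn k b})) (Set.range X)) ≤
        IsLocalRing.maximalIdeal (cDVring k b) := by
      rw [Ideal.span_le]
      rintro _ ⟨_, ⟨i, rfl⟩, rfl⟩
      exact xx_mem k b i
    rw [h] at this
    exact Ideal.IsPrime.ne_top inferInstance (top_le_iff.1 this)

theorem maximalIdeal_R : IsLocalRing.maximalIdeal (cDVring k b) =
    Ideal.span (Set.range (xx k b)) := by
  rw [← maximalIdeal_map, Ideal.map_span, ← Set.range_comp]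
  rfl

theorem precompleteR (M : Type) [AddCommGroup M] [Module (cDVring k b) M]
    [Module.Finite (cDVring k b) M] : IsPrecomplete (IsLocalRing.maximalIdeal (cDVring k b)) M := by
  let _ : Module (MvPowerSeries (Fin 4) k) M :=
    Module.compHom M (Ideal.Quotient.mk (Ideal.span {cDVeqn k b}))
  have : IsScalarTower (MvPowerSeries (Fin 4) k) (cDVring k b) M := by
    refine ⟨fun r s m => ?_⟩
    have h1 : r • s = (Ideal.Quotient.mk (Ideal.span {cDVeqn k b}) r) * s :=
      Algebra.smul_def r s
    rw [h1, mul_smul]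
    rfl
  have : Module.Finite (MvPowerSeries (Fin 4) k) M := Module.Finite.trans (cDVring k b) M
  have h := precomplete_finite (Ideal.span (Set.range X)) (P := MvPowerSeries (Fin 4) k) M
  rw [← maximalIdeal_map]
  exact (IsPrecomplete.map_algebraMap_iff (S := cDVring k b)).2 h

theorem rel : xx k b 0 ^ 2 + xx k b 1 ^ 2 + xx k b 2 ^ 2 - xx k b 3 ^ (2 * b + 1) = 0 := by
  simp only [xx, ← map_pow, ← map_add, ← map_sub]
  exact Ideal.Quotient.eq_zero_iff_mem.2 (Ideal.subset_span rfl)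

end concrete

end CDV




namespace CDV

section concrete

variable (k : Type) [Field k] (b : ℕ)

/-- The Euler derivation upstairs, twisted by a rotation of `x, y`. -/
noncomputable def DP (s : k) : Derivation k (MvPowerSeries (Fin 4) k) (MvPowerSeries (Fin 4) k) :=
  (((2 * b + 1 : ℕ) : MvPowerSeries (Fin 4) k) * X 0 - C s * X 1) • pderiv k 0 +
  (((2 * b + 1 : ℕ) : MvPowerSeries (Fin 4) k) * X 1 + C s * X 0) • pderiv k 1 +
  (((2 * b + 1 : ℕ) : MvPowerSeries (Fin 4) k) * X 2) • pderiv k 2 +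
  (2 * X 3 : MvPowerSeries (Fin 4) k) • pderiv k 3

theorem DP_X0 (s : k) : DP k b s (X 0) = ((2 * b + 1 : ℕ) : MvPowerSeries (Fin 4) k) * X 0 - C s * X 1 := by
  simp [DP]
theorem DP_X1 (s : k) : DP k b s (X 1) = ((2 * b + 1 : ℕ) : MvPowerSeries (Fin 4) k) * X 1 + C s * X 0 := by
  simp [DP]
theorem DP_X2 (s : k) : DP k b s (X 2) = ((2 * b + 1 : ℕ) : MvPowerSeries (Fin 4) k) * X 2 := by
  simp [DP]
theorem DP_X3 (s : k) : DP k b s (X 3) = 2 * X 3 := by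
  simp [DP]

theorem DP_eqn (s : k) : DP k b s (cDVeqn k b) = (2 * ((2 * b + 1 : ℕ) : MvPowerSeries (Fin 4) k)) * cDVeqn k b := by
  simp only [cDVeqn, map_add, map_sub, Derivation.leibniz_pow, DP_X0, DP_X1, DP_X2, DP_X3, smul_eq_mul,
    nsmul_eq_mul]
  rw [Nat.add_sub_cancel (2 * b) 1]
  push_cast
  ring

theorem exists_D (s : k) : ∃ D : Derivation k (cDVring k b) (cDVring k b), ∀ r,
    D (Ideal.Quotient.mk _ r) = Ideal.Quotient.mk _ (DP k b s r) := by
  let mkA : MvPowerSeries (Fin 4) k →ₐ[k] cDVring k b := Ideal.Quotient.mkₐ k _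
  have hker : ∀ r, mkA r = 0 → mkA (DP k b s r) = 0 := by
    intro r hr
    have : r ∈ Ideal.span {cDVeqn k b} := Ideal.Quotient.eq_zero_iff_mem.1 hr
    obtain ⟨q, rfl⟩ := Ideal.mem_span_singleton.1 this
    apply Ideal.Quotient.eq_zero_iff_mem.2
    rw [Derivation.leibniz, DP_eqn, Ideal.mem_span_singleton, smul_eq_mul, smul_eq_mul]
    exact ⟨DP k b s q + q * (2 * ((2 * b + 1 : ℕ) : MvPowerSeries (Fin 4) k)), by ring⟩
  have hs : Function.Surjective mkA := Ideal.Quotient.mk_surjective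
  choose t ht using hs
  refine ⟨Derivation.liftOfRightInverse (f := mkA) (f_inv := t) ht hker, fun r => ?_⟩
  exact Derivation.liftOfRightInverse_apply ht hker r

end concrete

end CDV




namespace CDV

theorem Dbl.exists_conj {B R : Type*} [CommRing B] [CommRing R] [Algebra B R] {z : R} {g : B}
    {a0 a1 : R →ₗ[B] B} (h : Dbl B R z g a0 a1) :
    ∃ σ : R →+* R, (∀ c, σ (algebraMap B R c) = algebraMap B R c) ∧ σ z = -z := by
  have hm : ∀ r s, a0 (r * s) = a0 r * a0 s + g * (a1 r * a1 s) ∧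
      a1 (r * s) = a0 r * a1 s + a1 r * a0 s := by
    intro r s
    have : r * s = algebraMap B R (a0 r * a0 s + g * (a1 r * a1 s)) +
        algebraMap B R (a0 r * a1 s + a1 r * a0 s) * z := by
      conv_lhs => rw [h.dec r, h.dec s]
      simp only [map_add, map_mul, ← h.sq]
      ring
    rw [this, h.c0, h.c1]
    exact ⟨rfl, rfl⟩
  have h1 : ∀ c, a0 (algebraMap B R c) = c ∧ a1 (algebraMap B R c) = 0 := fun c => ⟨h.c0a c, h.c1a c⟩
  refine ⟨{ toFun := fun r => algebraMap B R (a0 r) - algebraMap B R (a1 r) * z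
            map_one' := ?_, map_mul' := ?_, map_zero' := ?_, map_add' := ?_ }, ?_, ?_⟩
  · rw [← map_one (algebraMap B R), (h1 1).1, (h1 1).2]; simp
  · intro r s
    rw [(hm r s).1, (hm r s).2]
    simp only [map_add, map_mul, ← h.sq]
    ring
  · simp
  · intro r s
    simp only [map_add]
    ring
  · intro c
    change algebraMap B R (a0 _) - algebraMap B R (a1 _) * z = _
    rw [(h1 c).1, (h1 c).2]; simp
  · change algebraMap B R (a0 _) - algebraMap B R (a1 _) * z = _
    have h2 := h.c0z 1
    have h3 := h.c1z 1
    rw [← map_one (algebraMap B R), (h1 1).2, map_one, mul_one, mul_zero] at h2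
    rw [← map_one (algebraMap B R), (h1 1).1, map_one, mul_one] at h3
    rw [h2, h3]; simp

section concrete

variable (k : Type) [Field k] (b : ℕ)

/-- Eigen-coordinates. -/
noncomputable def xs (s : k) : Fin 4 → cDVring k b :=
  ![xx k b 0 + algebraMap k _ s * xx k b 1, xx k b 0 - algebraMap k _ s * xx k b 1, xx k b 2, xx k b 3]

theorem gen_xs [CharZero k] {s : k} (hs : s * s = -1) (r : cDVring k b) :
    ∃ (c : k) (q : Fin 4 → cDVring k b),
    r = algebraMap k (cDVring k b) c + ∑ i, xs k b s i * q i := by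
  obtain ⟨c, q, hq⟩ := gen_xx k b r
  have h2 : algebraMap k (cDVring k b) (1 / 2) * 2 = 1 := by
    rw [← map_ofNat (algebraMap k (cDVring k b)) 2, ← map_mul]; simp
  have h3 : algebraMap k (cDVring k b) s * algebraMap k (cDVring k b) s = -1 := by
    rw [← map_mul, hs]; simp
  refine ⟨c, ![algebraMap k _ (1/2) * (q 0 - algebraMap k _ s * q 1),
    algebraMap k _ (1/2) * (q 0 + algebraMap k _ s * q 1), q 2, q 3], ?_⟩
  rw [hq, Fin.sum_univ_four, Fin.sum_univ_four]
  simp only [xs, Matrix.cons_val]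
  generalize algebraMap k (cDVring k b) (1 / 2) = h at *
  generalize algebraMap k (cDVring k b) s = t at *
  linear_combination (-(xx k b 0 * q 0) - xx k b 1 * q 1) * h2 + 2 * h * xx k b 1 * q 1 * h3

theorem span_xs [CharZero k] {s : k} (hs : s * s = -1) :
    IsLocalRing.maximalIdeal (cDVring k b) = Ideal.span (Set.range (xs k b s)) := by
  have h2 : algebraMap k (cDVring k b) (1 / 2) * 2 = 1 := by
    rw [← map_ofNat (algebraMap k (cDVring k b)) 2, ← map_mul]; simp
  have h3 : algebraMap k (cDVring k b) s * algebraMap k (cDVring k b) s = -1 := by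
    rw [← map_mul, hs]; simp
  have hmem : ∀ i, xs k b s i ∈ Ideal.span (Set.range (xs k b s)) :=
    fun i => Ideal.subset_span ⟨i, rfl⟩
  have m0 := hmem 0
  have m1 := hmem 1
  have m2 := hmem 2
  have m3 := hmem 3
  apply le_antisymm
  · rw [maximalIdeal_R, Ideal.span_le]
    rintro _ ⟨i, rfl⟩
    have e0 : xx k b 0 = algebraMap k _ (1/2) * xs k b s 0 + algebraMap k _ (1/2) * xs k b s 1 := by
      simp only [xs, Matrix.cons_val]
      linear_combination (-xx k b 0) * h2
    have e1 : xx k b 1 = (-algebraMap k _ s * algebraMap k _ (1/2)) * xs k b s 0 +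
        (algebraMap k _ s * algebraMap k _ (1/2)) * xs k b s 1 := by
      simp only [xs, Matrix.cons_val]
      linear_combination (-xx k b 1) * h2 + 2 * algebraMap k _ (1/2) * xx k b 1 * h3
    obtain rfl | rfl | rfl | rfl : i = 0 ∨ i = 1 ∨ i = 2 ∨ i = 3 := by omega
    · rw [e0]; exact add_mem (Ideal.mul_mem_left _ _ m0) (Ideal.mul_mem_left _ _ m1)
    · rw [e1]; exact add_mem (Ideal.mul_mem_left _ _ m0) (Ideal.mul_mem_left _ _ m1)
    · exact m2
    · exact m3
  · rw [Ideal.span_le]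
    rintro _ ⟨i, rfl⟩
    have x0 := xx_mem k b 0
    have x1 := xx_mem k b 1
    obtain rfl | rfl | rfl | rfl : i = 0 ∨ i = 1 ∨ i = 2 ∨ i = 3 := by omega
    · exact add_mem x0 (Ideal.mul_mem_left _ _ x1)
    · exact sub_mem x0 (Ideal.mul_mem_left _ _ x1)
    · exact xx_mem k b 2
    · exact xx_mem k b 3

/-- The weights. -/
def ww (b : ℕ) : Fin 4 → ℤ := ![2 * b, 2 * b + 2, 2 * b + 1, 2]

theorem exists_D' {s : k} (hs : s * s = -1) : ∃ D : Derivation k (cDVring k b) (cDVring k b),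
    ∀ i, D (xs k b s i) = algebraMap k _ (ww b i : k) * xs k b s i := by
  obtain ⟨D, hD⟩ := exists_D k b s
  have h3 : algebraMap k (cDVring k b) s * algebraMap k (cDVring k b) s = -1 := by
    rw [← map_mul, hs]; simp
  have d0 : D (xx k b 0) = (2 * b + 1) * xx k b 0 - algebraMap k _ s * xx k b 1 := by
    rw [xx, hD, DP_X0, map_sub, map_mul, map_mul, map_natCast]; push_cast; rfl
  have d1 : D (xx k b 1) = (2 * b + 1) * xx k b 1 + algebraMap k _ s * xx k b 0 := by
    rw [xx, hD, DP_X1, map_add, map_mul, map_mul, map_natCast]; push_cast; rfl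
  have d2 : D (xx k b 2) = (2 * b + 1) * xx k b 2 := by
    rw [xx, hD, DP_X2, map_mul, map_natCast]; push_cast; rfl
  have d3 : D (xx k b 3) = 2 * xx k b 3 := by
    rw [xx, hD, DP_X3, map_mul, map_ofNat]
  have hs' : ∀ r, D (algebraMap k _ s * r) = algebraMap k _ s * D r := by
    intro r
    rw [Derivation.leibniz, Derivation.map_algebraMap, smul_zero, add_zero, smul_eq_mul]
  refine ⟨D, fun i => ?_⟩
  obtain rfl | rfl | rfl | rfl : i = 0 ∨ i = 1 ∨ i = 2 ∨ i = 3 := by omega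
  · simp only [xs, ww, Matrix.cons_val, map_add, hs', d0, d1]
    push_cast
    simp only [map_ofNat]
    linear_combination xx k b 0 * h3
  · simp only [xs, ww, Matrix.cons_val, map_sub, hs', d0, d1]
    push_cast
    simp only [map_ofNat]
    linear_combination (-xx k b 0) * h3
  · simp only [xs, ww, Matrix.cons_val, d2]
    push_cast
    simp only [map_ofNat]
  · simp only [xs, ww, Matrix.cons_val, d3]
    push_cast
    simp only [map_ofNat]

theorem exists_sigma : ∃ σ : cDVring k b →ₐ[k] cDVring k b,
    (∀ c, σ (jmap k b 2 c) = jmap k b 2 c) ∧ σ (xx k b 2) = - xx k b 2 ∧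
    ∀ (s : k) i, σ (xs k b s i) = algebraMap k _ ((-1 : k) ^ (ww b i)) * xs k b s i := by
  let _ := (jmap k b 2).toAlgebra
  obtain ⟨a0, a1, h⟩ := dbl_exists k b 2 (by decide)
  obtain ⟨σ, h1, h2⟩ := h.exists_conj
  have h1' : ∀ c, σ (jmap k b 2 c) = jmap k b 2 c := h1
  let σ' : cDVring k b →ₐ[k] cDVring k b :=
    { σ with commutes' := fun c => by rw [← jmap_C k b 2 c]; exact h1' _ }
  have e0 : σ' (xx k b 0) = xx k b 0 := by
    have := h1' (X 0); rw [jmap_X] at this; exact this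
  have e1 : σ' (xx k b 1) = xx k b 1 := by
    have := h1' (X 1); rw [jmap_X] at this; exact this
  have e3 : σ' (xx k b 3) = xx k b 3 := by
    have := h1' (X 2); rw [jmap_X] at this; exact this
  have e2 : σ' (xx k b 2) = - xx k b 2 := h2
  refine ⟨σ', h1', h2, ?_⟩
  intro s i
  obtain rfl | rfl | rfl | rfl : i = 0 ∨ i = 1 ∨ i = 2 ∨ i = 3 := by omega
  · have : ((-1 : k) ^ (ww b 0)) = 1 := Even.neg_one_zpow ⟨b, by simp [ww]; ring⟩
    rw [this]
    simp [xs, e0, e1]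
  · have : ((-1 : k) ^ (ww b 1)) = 1 := Even.neg_one_zpow ⟨b + 1, by simp [ww]; ring⟩
    rw [this]
    simp [xs, e0, e1]
  · have : ((-1 : k) ^ (ww b 2)) = -1 := Odd.neg_one_zpow ⟨b, by simp [ww]⟩
    rw [this]
    simp only [xs, Matrix.cons_val, e2, map_neg, map_one]
    ring
  · have : ((-1 : k) ^ (ww b 3)) = 1 := Even.neg_one_zpow ⟨1, by simp [ww]⟩
    rw [this]
    simp [xs, e3]

/-- The matrix factorization. -/
theorem exists_phi [IsAlgClosed k] (hb : 1 ≤ b) : ∃ φ : Matrix (Fin 4) (Fin 4) (BB k),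
    φ * φ = gB k b • (1 : Matrix (Fin 4) (Fin 4) (BB k)) ∧
    ∀ i j, φ i j ∈ IsLocalRing.maximalIdeal (BB k) := by
  obtain ⟨s, hs⟩ := IsAlgClosed.exists_pow_nat_eq (-1 : k) (n := 2) (by norm_num)
  have hs' : (C s : BB k) * C s = -1 := by
    rw [← map_mul, ← sq, hs]; simp
  let u : BB k := X 0 + C s * X 1
  let v : BB k := X 0 - C s * X 1
  let t : BB k := X 2
  let t' : BB k := X 2 ^ (2 * b)
  have hg : t * t' - u * v = gB k b := by
    simp only [u, v, t, t', gB]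
    linear_combination (X 1 ^ 2) * hs'
  have hX : ∀ i, (X i : BB k) ∈ IsLocalRing.maximalIdeal (BB k) := fun i => by
    simp [isUnit_iff_constantCoeff]
  have hu : u ∈ IsLocalRing.maximalIdeal (BB k) :=
    add_mem (hX 0) (Ideal.mul_mem_left _ _ (hX 1))
  have hv : v ∈ IsLocalRing.maximalIdeal (BB k) :=
    sub_mem (hX 0) (Ideal.mul_mem_left _ _ (hX 1))
  have ht : t ∈ IsLocalRing.maximalIdeal (BB k) := hX 2
  have ht' : t' ∈ IsLocalRing.maximalIdeal (BB k) :=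
    Ideal.pow_mem_of_mem _ (hX 2) _ (by omega)
  refine ⟨!![0, 0, t, u; 0, 0, v, t'; t', -u, 0, 0; -v, t, 0, 0], ?_, ?_⟩
  · rw [← hg]
    ext i j
    fin_cases i <;> fin_cases j <;>
      simp [Matrix.mul_apply, Fin.sum_univ_four] <;> ring_nf
  · intro i j
    fin_cases i <;> fin_cases j <;> simp <;> assumption

end concrete

end CDV




namespace CDV

theorem reg3_of_depth {R : Type} [CommRing R] [IsLocalRing R] {M : Type} [AddCommGroup M] [Module R M]
    (h : DepthGE R M 3) : ∃ r1 r2 r3 : R, r1 ∈ IsLocalRing.maximalIdeal R ∧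
      r2 ∈ IsLocalRing.maximalIdeal R ∧ r3 ∈ IsLocalRing.maximalIdeal R ∧ Reg3 r1 r2 r3 M := by
  obtain ⟨rs, hlen, hnu, hreg⟩ := h
  obtain ⟨r1, r2, r3, rfl⟩ := List.length_eq_three.1 hlen
  refine ⟨r1, r2, r3, hnu _ (by simp), hnu _ (by simp), hnu _ (by simp), ?_⟩
  have hw := hreg.toIsWeaklyRegular.regular_mod_prev
  have h0 := hw 0 (by simp)
  have h1 := hw 1 (by simp)
  have h2 := hw 2 (by simp)
  rw [isSMulRegular_quotient_iff_mem_of_smul_mem] at h0 h1 h2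
  simp only [List.take_succ_cons, List.take_zero, Ideal.ofList_nil, Ideal.ofList_cons, List.getElem_cons_zero,
    List.getElem_cons_succ, sup_bot_eq, Submodule.bot_smul, Submodule.mem_bot, Submodule.sup_smul,
    Submodule.ideal_span_singleton_smul, Submodule.mem_sup, Submodule.mem_smul_pointwise_iff_exists,
    Submodule.mem_top, true_and] at h0 h1 h2
  refine ⟨h0, ?_, ?_⟩
  · intro w w' hww
    obtain ⟨v, hv⟩ := h1 w ⟨w', hww.symm⟩
    exact ⟨v, hv.symm⟩
  · intro w w1 w2 hww
    obtain ⟨_, ⟨v1, rfl⟩, _, ⟨v2, rfl⟩, hv⟩ := h2 w ⟨_, ⟨w1, rfl⟩, _, ⟨w2, rfl⟩, hww.symm⟩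
    exact ⟨v1, v2, hv.symm⟩

theorem reflexive_pres {R : Type*} [CommRing R] [IsNoetherianRing R] {M : Type*} [AddCommGroup M]
    [Module R M] [Module.Finite R M] [Module.IsReflexive R M] :
    ∃ (p q : ℕ) (ι : M →ₗ[R] (Fin p → R)) (ρ : (Fin p → R) →ₗ[R] (Fin q → R)),
      Function.Injective ι ∧ LinearMap.range ι = LinearMap.ker ρ := by
  have hdf : Module.Finite R (Module.Dual R M) := inferInstance
  obtain ⟨p, f, hf⟩ := Module.Finite.exists_fin' R (Module.Dual R M)
  obtain ⟨q, g, hg⟩ := Module.Finite.exists_fin' R (LinearMap.ker f)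
  let fe : Fin p → Module.Dual R M := fun i => f (Pi.single i 1)
  let ge : Fin q → (Fin p → R) := fun j => g (Pi.single j 1)
  have hfs : ∀ v, f v = ∑ i, v i • fe i := by
    intro v
    conv_lhs => rw [pi_eq_sum_univ v, map_sum]
    refine Finset.sum_congr rfl fun i _ => ?_
    rw [map_smul]
    congr 2
    ext j
    simp [Pi.single_apply, eq_comm]
  let ι : M →ₗ[R] (Fin p → R) := LinearMap.pi fe
  let ρ : (Fin p → R) →ₗ[R] (Fin q → R) := LinearMap.pi fun j => ∑ i, ge j i • LinearMap.proj i
  have hρ : ∀ v j, ρ v j = ∑ i, ge j i * v i := by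
    intro v j
    simp [ρ]
  refine ⟨p, q, ι, ρ, ?_, ?_⟩
  · rw [injective_iff_map_eq_zero]
    intro m hm
    apply (Module.bijective_dual_eval R M).1
    rw [map_zero]
    ext d
    obtain ⟨v, rfl⟩ := hf d
    rw [hfs]
    have : ∀ i, fe i m = 0 := fun i => congrFun hm i
    simp [this]
  · apply le_antisymm
    · rintro _ ⟨m, rfl⟩
      rw [LinearMap.mem_ker]
      ext j
      rw [hρ]
      have h1 : f (ge j) = 0 := (g (Pi.single j 1)).2
      rw [hfs] at h1
      change ∑ i, ge j i * fe i m = 0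
      simpa using congrArg (fun d => d m) h1
    · intro w hw
      have hw' : ∀ j, ∑ i, ge j i * w i = 0 := by
        intro j
        rw [← hρ, LinearMap.mem_ker.1 hw]; rfl
      let W : (Fin p → R) →ₗ[R] R := ∑ i, w i • LinearMap.proj i
      have hW : ∀ v, W v = ∑ i, w i * v i := fun v => by simp [W]
      have hker : LinearMap.ker f ≤ LinearMap.ker W := by
        intro v hv
        obtain ⟨c, hc⟩ := hg ⟨v, hv⟩
        have h2 : (W.comp (Submodule.subtype _)).comp g = 0 := by
          apply LinearMap.pi_ext'
          intro j
          ext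
          simp only [LinearMap.comp_apply, LinearMap.single_apply]
          rw [Submodule.subtype_apply, hW]
          have := hw' j
          simp only [mul_comm (w _)]
          exact this
        have h3 := LinearMap.congr_fun h2 c
        rw [LinearMap.comp_apply, hc] at h3
        exact h3
      let Φ : Module.Dual R M →ₗ[R] R := (Submodule.liftQ _ W hker).comp
        (f.quotKerEquivOfSurjective hf).symm.toLinearMap
      have hΦ : ∀ v, Φ (f v) = W v := by
        intro v
        have : (f.quotKerEquivOfSurjective hf).symm (f v) = Submodule.Quotient.mk v := by
          rw [LinearEquiv.symm_apply_eq]; rfl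
        simp only [Φ, LinearMap.comp_apply, LinearEquiv.coe_coe, this, Submodule.liftQ_apply]
      obtain ⟨m, hm⟩ := (Module.bijective_dual_eval R M).2 Φ
      refine ⟨m, ?_⟩
      ext i
      have h4 : Φ (fe i) = fe i m := by rw [← hm]; rfl
      change fe i m = w i
      rw [← h4, hΦ, hW]
      simp [Pi.single_apply]

end CDV




namespace CDV

theorem main_abstract {k R B M : Type} [Field k] [IsAlgClosed k] [CharZero k] [CommRing R] [CommRing B]
    [IsLocalRing R] [IsNoetherianRing R] [IsLocalRing B] [IsNoetherianRing B] [Algebra k R]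
    [Algebra B R] [AddCommGroup M] [Module R M] [Module.Finite R M] [Nontrivial M]
    {z : R} {g : B} {a0 a1 : R →ₗ[B] B} (h : Dbl B R z g a0 a1) {y a c : B}
    (hm : IsLocalRing.maximalIdeal B = Ideal.span {y, a, c}) (hB : Reg3 y a c B)
    {p q : ℕ} (ι : M →ₗ[R] (Fin p → R)) (ρ : (Fin p → R) →ₗ[R] (Fin q → R))
    (hι : Function.Injective ι) (hex : LinearMap.range ι = LinearMap.ker ρ)
    (hrad : ∀ (n : ℕ) (π : (Fin n → R) →ₗ[R] M), Function.Surjective π →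
      ∃ N, IsLocalRing.maximalIdeal R ^ N ≤ AnnI π)
    (hy : algebraMap B R y ∈ IsLocalRing.maximalIdeal R)
    (ha : algebraMap B R a ∈ IsLocalRing.maximalIdeal R)
    {r1 r2 r3 : R} (h1 : r1 ∈ IsLocalRing.maximalIdeal R) (h2 : r2 ∈ IsLocalRing.maximalIdeal R)
    (h3 : r3 ∈ IsLocalRing.maximalIdeal R) (hA : Reg3 r1 r2 r3 (Module.End R M))
    {κ : Type} [Fintype κ]
    (x : κ → R) (w : κ → ℤ) (hI : IsLocalRing.maximalIdeal R = Ideal.span (Set.range x))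
    (hgen : ∀ r : R, ∃ (c : k) (q : κ → R), r = algebraMap k R c + ∑ i, x i * q i)
    (D : Derivation k R R) (hD : ∀ i, D (x i) = algebraMap k R (w i : k) * x i)
    (σ : R →ₐ[k] R) (hσ : ∀ i, σ (x i) = algebraMap k R ((-1 : k) ^ (w i)) * x i)
    (hσB : ∀ b, σ (algebraMap B R b) = algebraMap B R b) (hσz : σ z = -z)
    [IsPrecomplete (IsLocalRing.maximalIdeal R) M] : Module.Projective R M := by
  let _ : Module k M := Module.compHom M (algebraMap k R)
  have : IsScalarTower k R M := IsScalarTower.of_algebraMap_smul fun _ _ => rfl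
  let _ : Module B M := Module.compHom M (algebraMap B R)
  have : IsScalarTower B R M := IsScalarTower.of_algebraMap_smul fun _ _ => rfl
  have : Module.Free B R := h.free
  have : Module.Finite B R := h.finite
  have : Module.Finite B M := Module.Finite.trans R M
  have hbm : ∀ (b : B) (m : M), b • m = algebraMap B R b • m := fun _ _ => rfl
  have hbp : ∀ (l : ℕ) (b : B) (m : Fin l → R), b • m = algebraMap B R b • m := fun l b m =>
    (algebraMap_smul R b m).symm
  have hregp : ∀ l, Reg3 y a c (Fin l → R) := fun l => reg3_free hB
  have hsat : ∀ u : Fin p → R, algebraMap B R y • u ∈ LinearMap.range ι → u ∈ LinearMap.range ι := by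
    intro u hu
    rw [hex, LinearMap.mem_ker, map_smul, ← hbp] at hu
    rw [hex, LinearMap.mem_ker]
    exact (hregp q).r1 _ hu
  have hM1 : ∀ m : M, algebraMap B R y • m = 0 → m = 0 := by
    intro m hm0
    apply hι
    rw [map_zero]
    apply (hregp p).r1
    rw [hbp, ← map_smul, hm0, map_zero]
  have hM2 : ∀ w w' : M, algebraMap B R a • w = algebraMap B R y • w' →
      ∃ v, w = algebraMap B R y • v := by
    intro w w' hww
    obtain ⟨u, hu⟩ := (hregp p).r2 (ι w) (ι w') (by rw [hbp, hbp, ← map_smul, ← map_smul, hww])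
    rw [hbp] at hu
    obtain ⟨v, rfl⟩ := hsat u ⟨w, hu⟩
    exact ⟨v, hι (by rw [hu, map_smul])⟩
  obtain ⟨n, pp, hpp, hmin⟩ := exists_min_pres (B := B) (N := M)
  let π : (Fin n → R) →ₗ[R] M := Fintype.linearCombination R (fun i => pp (Pi.single i 1))
  have hpps : ∀ v : Fin n → B, pp v = ∑ i, v i • pp (Pi.single i 1) := by
    intro v
    conv_lhs => rw [pi_eq_sum_univ v, map_sum]
    refine Finset.sum_congr rfl fun i _ => ?_
    rw [map_smul]
    congr 2
    ext j
    simp [Pi.single_apply, eq_comm]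
  have hπf : ∀ f, π f = pp (fun i => a0 (f i)) + z • pp (fun i => a1 (f i)) := by
    intro f
    rw [hpps, hpps, Finset.smul_sum, ← Finset.sum_add_distrib]
    simp only [π, Fintype.linearCombination_apply]
    refine Finset.sum_congr rfl fun i _ => ?_
    conv_lhs => rw [h.dec (f i), add_smul, mul_comm, mul_smul]
    rfl
  have hπ : Function.Surjective π := by
    intro m
    obtain ⟨v, rfl⟩ := hpp m
    refine ⟨fun i => algebraMap B R (v i), ?_⟩
    rw [hpps]
    simp only [π, Fintype.linearCombination_apply]
    rfl
  obtain ⟨N, hN⟩ := hrad n π hπ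
  have hrig := rigid π hπ (IsLocalRing.maximalIdeal R) h1 h2 h3 hy ha hA hM1 hM2 N hN
  have hfree : Module.Free B (LinearMap.ker pp) := by
    have h4 := ker_free hm hB ((ι.restrictScalars B).comp pp) (by
      rintro u ⟨v, hv⟩
      have hu : algebraMap B R y • u ∈ LinearMap.range ι := ⟨pp v, by rw [← hbp]; exact hv⟩
      obtain ⟨m, rfl⟩ := hsat u hu
      obtain ⟨v', rfl⟩ := hpp m
      exact ⟨v', rfl⟩)
    have h5 : LinearMap.ker ((ι.restrictScalars B).comp pp) = LinearMap.ker pp :=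
      LinearMap.ker_comp_of_ker_eq_bot _ (LinearMap.ker_eq_bot.2 hι)
    rwa [h5] at h4
  obtain ⟨Θ, hΘ2, hΘ⟩ := exists_semilinear x w (IsLocalRing.maximalIdeal R) hI hgen D
    (fun i => by rw [hD, Algebra.smul_def]) σ (fun i => by rw [hσ, Algebra.smul_def]) π hπ hrig
  exact proj_of_rigid h (σ : R →+* R) hσB hσz Θ.toAddMonoidHom hΘ2 hΘ pp hpp hmin hfree π hπf hrig

section concrete

variable (k : Type) [Field k] (b : ℕ)

theorem rad_ann [CharZero k] {M : Type} [AddCommGroup M] [Module (cDVring k b) M]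
    {p q : ℕ} (ι : M →ₗ[cDVring k b] (Fin p → cDVring k b))
    (ρ : (Fin p → cDVring k b) →ₗ[cDVring k b] (Fin q → cDVring k b))
    (hι : Function.Injective ι) (hex : LinearMap.range ι = LinearMap.ker ρ) (n : ℕ)
    (π : (Fin n → cDVring k b) →ₗ[cDVring k b] M) (hπ : Function.Surjective π) :
    ∃ N, IsLocalRing.maximalIdeal (cDVring k b) ^ N ≤ AnnI π := by
  have key : ∀ (i : Fin 4) (_ : i ≠ 3) (j : Fin 3),
      xx k b i * xx k b (i.succAbove j) ∈ (AnnI π).radical := by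
    intro i hi j
    let _ := (jmap k b i).toAlgebra
    obtain ⟨a0, a1, h⟩ := dbl_exists k b i hi
    have : Module.Free (BB k) (cDVring k b) := h.free
    have : Module.Finite (BB k) (cDVring k b) := h.finite
    obtain ⟨a, c, hja, hjc, hac⟩ : ∃ a c : Fin 3, j ≠ a ∧ j ≠ c ∧ a ≠ c := by
      revert j; decide
    obtain ⟨l, hl⟩ := double_mem_ann (B := BB k) (z := xx k b i) (g := gB k b)
      (fun r => ⟨_, _, h.dec r⟩) (by rw [sq, h.sq])
      (maximalIdeal_three hja hjc hac) (reg3_X hja hjc hac) ι ρ hι hex π hπ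
    have hl' : 2 * xx k b i * xx k b (i.succAbove j) ^ l ∈ AnnI π := by
      rw [← jmap_X]; exact hl
    have h2 : algebraMap k (cDVring k b) (1 / 2) * 2 = 1 := by
      rw [← map_ofNat (algebraMap k (cDVring k b)) 2, ← map_mul]; simp
    have h3 : xx k b i * xx k b (i.succAbove j) ^ l ∈ AnnI π := by
      have := Ideal.mul_mem_left _ (algebraMap k (cDVring k b) (1 / 2)) hl'
      rwa [← mul_assoc, ← mul_assoc, h2, one_mul] at this
    refine ⟨l + 1, ?_⟩
    have h4 : (xx k b i * xx k b (i.succAbove j)) ^ (l + 1) =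
        (xx k b i ^ l * xx k b (i.succAbove j)) * (xx k b i * xx k b (i.succAbove j) ^ l) := by ring
    rw [h4]
    exact Ideal.mul_mem_left _ _ h3
  have k01 : xx k b 0 * xx k b 1 ∈ (AnnI π).radical := key 0 (by decide) 0
  have k02 : xx k b 0 * xx k b 2 ∈ (AnnI π).radical := key 0 (by decide) 1
  have k03 : xx k b 0 * xx k b 3 ∈ (AnnI π).radical := key 0 (by decide) 2
  have k12 : xx k b 1 * xx k b 2 ∈ (AnnI π).radical := key 1 (by decide) 1
  have k13 : xx k b 1 * xx k b 3 ∈ (AnnI π).radical := key 1 (by decide) 2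
  have k23 : xx k b 2 * xx k b 3 ∈ (AnnI π).radical := key 2 (by decide) 2
  have hrel := rel k b
  have hrad : ∀ (r : cDVring k b) (m : ℕ), r ^ m ∈ (AnnI π).radical → r ∈ (AnnI π).radical := by
    intro r m hr
    rw [← Ideal.radical_idem]
    exact ⟨m, hr⟩
  have r0 : xx k b 0 ∈ (AnnI π).radical := by
    apply hrad _ 3
    have : xx k b 0 ^ 3 = xx k b 3 ^ (2 * b) * (xx k b 0 * xx k b 3) - xx k b 1 * (xx k b 0 * xx k b 1) -
      xx k b 2 * (xx k b 0 * xx k b 2) := by linear_combination xx k b 0 * hrel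
    rw [this]
    exact sub_mem (sub_mem (Ideal.mul_mem_left _ _ k03) (Ideal.mul_mem_left _ _ k01))
      (Ideal.mul_mem_left _ _ k02)
  have r1 : xx k b 1 ∈ (AnnI π).radical := by
    apply hrad _ 3
    have : xx k b 1 ^ 3 = xx k b 3 ^ (2 * b) * (xx k b 1 * xx k b 3) - xx k b 0 * (xx k b 0 * xx k b 1) -
      xx k b 2 * (xx k b 1 * xx k b 2) := by linear_combination xx k b 1 * hrel
    rw [this]
    exact sub_mem (sub_mem (Ideal.mul_mem_left _ _ k13) (Ideal.mul_mem_left _ _ k01))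
      (Ideal.mul_mem_left _ _ k12)
  have r2 : xx k b 2 ∈ (AnnI π).radical := by
    apply hrad _ 3
    have : xx k b 2 ^ 3 = xx k b 3 ^ (2 * b) * (xx k b 2 * xx k b 3) - xx k b 0 * (xx k b 0 * xx k b 2) -
      xx k b 1 * (xx k b 1 * xx k b 2) := by linear_combination xx k b 2 * hrel
    rw [this]
    exact sub_mem (sub_mem (Ideal.mul_mem_left _ _ k23) (Ideal.mul_mem_left _ _ k02))
      (Ideal.mul_mem_left _ _ k12)
  have r3 : xx k b 3 ∈ (AnnI π).radical := by
    apply hrad _ (2 * b + 1)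
    have : xx k b 3 ^ (2 * b + 1) = xx k b 0 * xx k b 0 + xx k b 1 * xx k b 1 + xx k b 2 * xx k b 2 := by
      linear_combination -hrel
    rw [this]
    exact add_mem (add_mem (Ideal.mul_mem_left _ _ r0) (Ideal.mul_mem_left _ _ r1))
      (Ideal.mul_mem_left _ _ r2)
  apply Ideal.exists_pow_le_of_le_radical_of_fg
  · rw [maximalIdeal_R, Ideal.span_le]
    rintro _ ⟨i, rfl⟩
    obtain rfl | rfl | rfl | rfl : i = 0 ∨ i = 1 ∨ i = 2 ∨ i = 3 := by omega
    exacts [r0, r1, r2, r3]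
  · exact IsNoetherian.noetherian _

end concrete

end CDV

open CDV
theorem stmt17 (k : Type) [Field k] [IsAlgClosed k] [CharZero k] (b : ℕ) (hb : 1 ≤ b) :
    ¬ ∃ (M : Type) (_ : AddCommGroup M) (_ : Module (cDVring k b) M),
        Module.Finite (cDVring k b) M ∧ Nontrivial M ∧
        Module.IsReflexive (cDVring k b) M ∧
        Module.Finite (cDVring k b) (Module.End (cDVring k b) M) ∧
        DepthGE (cDVring k b) (Module.End (cDVring k b) M) 3 ∧
        FiniteGlobalDimension (Module.End (cDVring k b) M) := by
  rintro ⟨M, _, _, hfin, hnt, hrefl, _, hdepth, hgd⟩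
  obtain ⟨r1, r2, r3, h1, h2, h3, hA⟩ := reg3_of_depth hdepth
  obtain ⟨p, q, ι, ρ, hι, hex⟩ := reflexive_pres (R := cDVring k b) (M := M)
  obtain ⟨s, hs⟩ := IsAlgClosed.exists_pow_nat_eq (-1 : k) (n := 2) (by norm_num)
  rw [sq] at hs
  obtain ⟨D, hD⟩ := exists_D' k b hs
  obtain ⟨σ, hσB, hσz, hσ⟩ := exists_sigma k b
  obtain ⟨φ, hφ, hφm⟩ := exists_phi k b hb
  let _ := (jmap k b 2).toAlgebra
  obtain ⟨a0, a1, h⟩ := dbl_exists k b 2 (by decide)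
  have hX : ∀ j : Fin 3, algebraMap (BB k) (cDVring k b) (X j) ∈
      IsLocalRing.maximalIdeal (cDVring k b) := by
    intro j
    have := xx_mem k b ((2 : Fin 4).succAbove j)
    rw [← jmap_X] at this
    exact this
  have hmap : ∀ r ∈ IsLocalRing.maximalIdeal (BB k), algebraMap (BB k) (cDVring k b) r ∈
      IsLocalRing.maximalIdeal (cDVring k b) := by
    intro r hr
    have h4 : IsLocalRing.maximalIdeal (BB k) ≤
        (IsLocalRing.maximalIdeal (cDVring k b)).comap (algebraMap (BB k) (cDVring k b)) := by
      rw [maximalIdeal_eq, Ideal.span_le]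
      rintro _ ⟨j, rfl⟩
      exact hX j
    exact h4 hr
  have := precompleteR k b M
  have hproj : Module.Projective (cDVring k b) M :=
    main_abstract (k := k) (B := BB k) h (y := X 0) (a := X 1) (c := X 2)
      (maximalIdeal_three (by decide) (by decide) (by decide))
      (reg3_X (by decide) (by decide) (by decide)) ι ρ hι hex (rad_ann k b ι ρ hι hex)
      (hX 0) (hX 1) h1 h2 h3 hA (xs k b s) (ww b) (span_xs k b hs) (gen_xs k b hs) D hD σ (hσ s)
      hσB hσz
  have hfree : Module.Free (cDVring k b) M := Module.free_of_flat_of_isLocalRing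
  exact not_finite_gldim h (n := 4) (by norm_num) φ hφ (xx_mem k b 2)
    (fun i j => hmap _ (hφm i j)) hgd
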